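/- arXiv:2106.07689 — 2 statements merged into one kernel-verified Lean document; each statement's English description precedes it below -/
import Mathlib

section
/- Let O ⊆ ℝᵈ be a nonempty bounded open set with boundary ∂O, and let (ε_n) be a sequence of positive real numbers with ε_n → 0. For each n, let u_n : ℝᵈ → ℝ be continuous on the closure of O, twice continuously differentiable on O, satisfy 0 < u_n(x) < 1 for all x ∈ O, u_n(x) = 0 for all x ∈ ∂O, and the equation −ε_n·Δu_n(x) + u_n(x) − 1 = 0 for all x ∈ O. Then the functions w_n(x) = −√(ε_n) · log(1 − u_n(x)) converge, as n → ∞, to the distance function x ↦ dist(x, ∂O) uniformly on every compact subset of the closure of O. -/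
open MeasureTheory Filter Topology Metric Set

/-- Laplacian: sum of the second partial derivatives along the standard basis. -/
noncomputable def laplacian {d : ℕ} (f : EuclideanSpace ℝ (Fin d) → ℝ)
    (x : EuclideanSpace ℝ (Fin d)) : ℝ :=
  ∑ i : Fin d, fderiv ℝ (fun y => fderiv ℝ f y (EuclideanSpace.single i 1)) x
    (EuclideanSpace.single i 1)


section calculus
variable {d : ℕ}

lemma fderiv_dir_diff {f : EuclideanSpace ℝ (Fin d) → ℝ} {x : EuclideanSpace ℝ (Fin d)}
    (hf : ContDiffAt ℝ 2 f x) (e : EuclideanSpace ℝ (Fin d)) :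
    DifferentiableAt ℝ (fun y => fderiv ℝ f y e) x := by
  have h : ContDiffAt ℝ 1 (fderiv ℝ f) x := hf.fderiv_right (by norm_num)
  exact (h.differentiableAt (by norm_num)).clm_apply (differentiableAt_const e)

lemma ev_diff {f : EuclideanSpace ℝ (Fin d) → ℝ} {x : EuclideanSpace ℝ (Fin d)}
    (hf : ContDiffAt ℝ 2 f x) : ∀ᶠ y in 𝓝 x, DifferentiableAt ℝ f y := by
  filter_upwards [hf.eventually (by norm_num)] with y hy
  exact hy.differentiableAt (by norm_num)

lemma laplacian_congr {f g : EuclideanSpace ℝ (Fin d) → ℝ} {x : EuclideanSpace ℝ (Fin d)}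
    (h : f =ᶠ[𝓝 x] g) : laplacian f x = laplacian g x := by
  unfold laplacian
  refine Finset.sum_congr rfl fun i _ => ?_
  have h2 : (fun y => fderiv ℝ f y (EuclideanSpace.single i 1)) =ᶠ[𝓝 x]
      (fun y => fderiv ℝ g y (EuclideanSpace.single i 1)) := by
    filter_upwards [h.fderiv (𝕜 := ℝ)] with y hy
    rw [hy]
  rw [h2.fderiv_eq]

lemma laplacian_sub {f g : EuclideanSpace ℝ (Fin d) → ℝ} {x : EuclideanSpace ℝ (Fin d)}
    (hf : ContDiffAt ℝ 2 f x) (hg : ContDiffAt ℝ 2 g x) :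
    laplacian (fun y => f y - g y) x = laplacian f x - laplacian g x := by
  unfold laplacian
  rw [← Finset.sum_sub_distrib]
  refine Finset.sum_congr rfl fun i _ => ?_
  have h2 : (fun y => fderiv ℝ (fun y => f y - g y) y (EuclideanSpace.single i 1)) =ᶠ[𝓝 x]
      (fun y => fderiv ℝ f y (EuclideanSpace.single i 1)
        - fderiv ℝ g y (EuclideanSpace.single i 1)) := by
    filter_upwards [ev_diff hf, ev_diff hg] with y h1 h2
    rw [fderiv_fun_sub h1 h2]; rfl
  rw [h2.fderiv_eq, fderiv_fun_sub (fderiv_dir_diff hf _) (fderiv_dir_diff hg _)]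
  rfl

lemma laplacian_const (c : ℝ) (x : EuclideanSpace ℝ (Fin d)) :
    laplacian (fun _ => c) x = 0 := by
  unfold laplacian
  simp

lemma laplacian_comp {F : EuclideanSpace ℝ (Fin d) → ℝ} {x : EuclideanSpace ℝ (Fin d)}
    (hF : ContDiffAt ℝ 2 F x) {g g' : ℝ → ℝ} {g'' : ℝ}
    (hg : ∀ᶠ q in 𝓝 (F x), HasDerivAt g (g' q) q) (hg' : HasDerivAt g' g'' (F x)) :
    laplacian (fun y => g (F y)) x =
      g'' * ∑ i : Fin d, (fderiv ℝ F x (EuclideanSpace.single i 1)) ^ 2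
        + g' (F x) * laplacian F x := by
  unfold laplacian
  rw [Finset.mul_sum, Finset.mul_sum, ← Finset.sum_add_distrib]
  refine Finset.sum_congr rfl fun i _ => ?_
  have h2 : (fun y => fderiv ℝ (fun y => g (F y)) y (EuclideanSpace.single i 1)) =ᶠ[𝓝 x]
      (fun y => g' (F y) * fderiv ℝ F y (EuclideanSpace.single i 1)) := by
    filter_upwards [ev_diff hF, hF.continuousAt.eventually hg] with y h1 h2
    have := (h2.comp_hasFDerivAt y h1.hasFDerivAt).fderiv
    change fderiv ℝ (g ∘ F) y _ = _
    rw [this]; rfl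
  have hd : HasFDerivAt F (fderiv ℝ F x) x := (hF.differentiableAt (by norm_num)).hasFDerivAt
  have h3 := (hg'.comp_hasFDerivAt x hd).mul (fderiv_dir_diff hF (EuclideanSpace.single i 1)).hasFDerivAt
  rw [h2.fderiv_eq]
  have h4 := h3.fderiv
  change fderiv ℝ (fun y => g' (F y) * fderiv ℝ F y (EuclideanSpace.single i 1)) x = _ at h4
  rw [h4]
  simp
  ring

lemma contDiff_nsq (c : EuclideanSpace ℝ (Fin d)) :
    ContDiff ℝ 2 (fun y => ‖y - c‖ ^ 2) :=
  (contDiff_id.sub contDiff_const).norm_sq ℝ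

lemma fderiv_nsq (c x e : EuclideanSpace ℝ (Fin d)) :
    fderiv ℝ (fun y => ‖y - c‖ ^ 2) x e = 2 * inner ℝ (x - c) e := by
  have := ((hasFDerivAt_id x).sub_const c).norm_sq
  simp only [id] at this
  rw [this.fderiv]
  simp [inner_sub_left]

lemma laplacian_radial (c x : EuclideanSpace ℝ (Fin d)) {g g' : ℝ → ℝ} {g'' : ℝ}
    (hg : ∀ᶠ q in 𝓝 (‖x - c‖ ^ 2), HasDerivAt g (g' q) q)
    (hg' : HasDerivAt g' g'' (‖x - c‖ ^ 2)) :
    laplacian (fun y => g (‖y - c‖ ^ 2)) x =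
      4 * ‖x - c‖ ^ 2 * g'' + 2 * d * g' (‖x - c‖ ^ 2) := by
  rw [laplacian_comp (contDiff_nsq c).contDiffAt hg hg']
  have h1 : ∑ i : Fin d, (fderiv ℝ (fun y => ‖y - c‖ ^ 2) x (EuclideanSpace.single i 1)) ^ 2
      = 4 * ‖x - c‖ ^ 2 := by
    rw [EuclideanSpace.norm_sq_eq, Finset.mul_sum]
    refine Finset.sum_congr rfl fun i _ => ?_
    rw [fderiv_nsq, EuclideanSpace.inner_single_right]
    simp
    ring
  have h2 : laplacian (fun y => ‖y - c‖ ^ 2) x = 2 * d := by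
    unfold laplacian
    have : ∀ i : Fin d, fderiv ℝ (fun y => fderiv ℝ (fun y => ‖y - c‖ ^ 2) y
        (EuclideanSpace.single i 1)) x (EuclideanSpace.single i 1) = 2 := by
      intro i
      simp only [fderiv_nsq]
      have h : HasFDerivAt (fun y => 2 * inner ℝ (y - c) (EuclideanSpace.single i (1:ℝ)))
        ((2:ℝ) • innerSL ℝ (EuclideanSpace.single i (1:ℝ))) x := by
        have := (((innerSL ℝ (EuclideanSpace.single i (1:ℝ))).hasFDerivAt (x := x - c)).comp x
          ((hasFDerivAt_id x).sub_const c)).const_mul 2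
        refine (this.congr_of_eventuallyEq (Eventually.of_forall fun y => ?_))
        simp [real_inner_comm]
      rw [h.fderiv]
      simp
    simp [this, mul_comm]
  rw [h1, h2]; ring

/-- second derivative test -/
lemma laplacian_nonpos {f : EuclideanSpace ℝ (Fin d) → ℝ} {x : EuclideanSpace ℝ (Fin d)}
    (hf : ContDiffAt ℝ 2 f x) (hm : IsLocalMax f x) : laplacian f x ≤ 0 := by
  unfold laplacian
  refine Finset.sum_nonpos fun i _ => ?_
  set e : EuclideanSpace ℝ (Fin d) := EuclideanSpace.single i 1
  by_contra! hpos
  have hl : ∀ t : ℝ, HasDerivAt (fun t : ℝ => x + t • e) e t := by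
    intro t
    simpa using ((hasDerivAt_id t).smul_const e).const_add x
  have hc : ContinuousAt (fun t : ℝ => x + t • e) 0 := (hl 0).continuousAt
  have ht : Tendsto (fun t : ℝ => x + t • e) (𝓝 0) (𝓝 x) := by
    have := hc.tendsto; simpa using this
  have h1 : deriv (fun t : ℝ => f (x + t • e)) =ᶠ[𝓝 0] fun t => fderiv ℝ f (x + t • e) e := by
    filter_upwards [ht.eventually (ev_diff hf)] with t h
    exact (h.hasFDerivAt.comp_hasDerivAt t (hl t)).deriv
  have hx0 : x + (0:ℝ) • e = x := by simp
  have h2 : deriv (deriv (fun t : ℝ => f (x + t • e))) 0 =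
      fderiv ℝ (fun y => fderiv ℝ f y e) x e := by
    rw [h1.deriv_eq]
    have hd : HasFDerivAt (fun y => fderiv ℝ f y e) (fderiv ℝ (fun y => fderiv ℝ f y e) x)
      (x + (0:ℝ) • e) := by rw [hx0]; exact (fderiv_dir_diff hf e).hasFDerivAt
    exact (hd.comp_hasDerivAt (0:ℝ) (hl 0)).deriv
  have hmax : IsLocalMax (fun t : ℝ => f (x + t • e)) 0 := by
    have := ht.eventually hm
    simpa [IsLocalMax, IsMaxFilter] using this
  have hcont : ContinuousAt (fun t : ℝ => f (x + t • e)) 0 := by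
    have h : ContinuousAt f (x + (0:ℝ) • e) := by rw [hx0]; exact hf.continuousAt
    exact ContinuousAt.comp (f := fun t : ℝ => x + t • e) h hc
  have hmin := isLocalMin_of_deriv_deriv_pos (by rw [h2]; exact hpos) hmax.deriv_eq_zero hcont
  have heq : (fun t : ℝ => f (x + t • e)) =ᶠ[𝓝 0] fun _ => f (x + (0:ℝ) • e) := by
    filter_upwards [hmax, hmin] with t a b
    exact le_antisymm a b
  have : deriv (deriv (fun t : ℝ => f (x + t • e))) 0 = 0 := by
    rw [heq.deriv.deriv_eq]; simp
  rw [h2] at this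
  linarith

lemma max_principle {K : Set (EuclideanSpace ℝ (Fin d))} (hK : IsCompact K)
    {f : EuclideanSpace ℝ (Fin d) → ℝ} (hf : ContinuousOn f K)
    (h : ∀ x ∈ K, 0 < f x → K ∈ 𝓝 x ∧ ContDiffAt ℝ 2 f x ∧ 0 < laplacian f x) :
    ∀ x ∈ K, f x ≤ 0 := by
  intro x hx
  obtain ⟨z, hz, hmax⟩ := hK.exists_isMaxOn ⟨x, hx⟩ hf
  by_contra! hpos
  obtain ⟨h1, h2, h3⟩ := h z hz (hpos.trans_le (hmax hx))
  have := laplacian_nonpos h2 (hmax.isLocalMax h1)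
  linarith

/-- Integration by parts. -/
lemma laplacian_ibp {Q k : EuclideanSpace ℝ (Fin d) → ℝ} (hQ : ContDiff ℝ 2 Q)
    (hk : ContDiff ℝ 2 k) (hc : HasCompactSupport k) :
    ∫ x, Q x * laplacian k x = ∫ x, laplacian Q x * k x := by
  have cf : ∀ {f : EuclideanSpace ℝ (Fin d) → ℝ}, ContDiff ℝ 2 f → ∀ e,
      ContDiff ℝ 1 (fun y => fderiv ℝ f y e) := fun hf e =>
    (hf.fderiv_right (by norm_num)).clm_apply contDiff_const
  have cff : ∀ {f : EuclideanSpace ℝ (Fin d) → ℝ}, ContDiff ℝ 2 f → ∀ e,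
      Continuous (fun x => fderiv ℝ (fun y => fderiv ℝ f y e) x e) := fun hf e =>
    ((cf hf e).continuous_fderiv (by norm_num)).clm_apply continuous_const
  have sk : ∀ e, HasCompactSupport (fun y => fderiv ℝ k y e) := fun e => hc.fderiv_apply ℝ e
  have skk : ∀ e, HasCompactSupport (fun x => fderiv ℝ (fun y => fderiv ℝ k y e) x e) :=
    fun e => (sk e).fderiv_apply ℝ e
  have key : ∀ e, Integrable (fun x => Q x * fderiv ℝ (fun y => fderiv ℝ k y e) x e) ∧
      Integrable (fun x => fderiv ℝ (fun y => fderiv ℝ Q y e) x e * k x) ∧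
      ∫ x, Q x * fderiv ℝ (fun y => fderiv ℝ k y e) x e =
       ∫ x, fderiv ℝ (fun y => fderiv ℝ Q y e) x e * k x := by
    intro e
    have i1 : Integrable (fun x => Q x * fderiv ℝ (fun y => fderiv ℝ k y e) x e) :=
      (hQ.continuous.mul (cff hk e)).integrable_of_hasCompactSupport ((skk e).mul_left)
    have i2 : Integrable (fun x => fderiv ℝ (fun y => fderiv ℝ Q y e) x e * k x) :=
      ((cff hQ e).mul hk.continuous).integrable_of_hasCompactSupport (hc.mul_left)
    have i3 : Integrable (fun x => fderiv ℝ Q x e * fderiv ℝ k x e) :=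
      ((cf hQ e).continuous.mul (cf hk e).continuous).integrable_of_hasCompactSupport
        ((sk e).mul_left)
    have i4 : Integrable (fun x => Q x * fderiv ℝ k x e) :=
      (hQ.continuous.mul (cf hk e).continuous).integrable_of_hasCompactSupport
        ((sk e).mul_left)
    have i5 : Integrable (fun x => fderiv ℝ Q x e * k x) :=
      ((cf hQ e).continuous.mul hk.continuous).integrable_of_hasCompactSupport
        (hc.mul_left)
    refine ⟨i1, i2, ?_⟩
    rw [integral_mul_fderiv_eq_neg_fderiv_mul_of_integrable i3 i1 i4
      (fun x _ => hQ.differentiable (by norm_num) x)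
      (fun x _ => (cf hk e).differentiable (by norm_num) x),
      integral_mul_fderiv_eq_neg_fderiv_mul_of_integrable i2 i3 i5
      (fun x _ => (cf hQ e).differentiable (by norm_num) x)
      (fun x _ => hk.differentiable (by norm_num) x), neg_neg]
  unfold laplacian
  simp only [Finset.mul_sum, Finset.sum_mul]
  rw [integral_finsetSum _ (fun i _ => (key _).1), integral_finsetSum _ (fun i _ => (key _).2.1)]
  exact Finset.sum_congr rfl fun i _ => (key _).2.2

lemma laplacian_continuous {f : EuclideanSpace ℝ (Fin d) → ℝ} (hf : ContDiff ℝ 2 f) :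
    Continuous (laplacian f) := by
  unfold laplacian
  refine continuous_finsetSum _ fun i _ => ?_
  have : ContDiff ℝ 1 (fun y => fderiv ℝ f y (EuclideanSpace.single i 1)) :=
    (hf.fderiv_right (by norm_num)).clm_apply contDiff_const
  exact (this.continuous_fderiv (by norm_num)).clm_apply continuous_const

end calculus

section kernels
variable {d : ℕ}

lemma hasDerivAt_pospow (n : ℕ) (t : ℝ) :
    HasDerivAt (fun t : ℝ => max t 0 ^ (n + 2)) ((n + 2) * max t 0 ^ (n + 1)) t := by
  rcases lt_trichotomy t 0 with h | h | h
  · have : (fun t : ℝ => max t 0 ^ (n + 2)) =ᶠ[𝓝 t] fun _ => 0 := by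
      filter_upwards [Iio_mem_nhds h] with s hs
      rw [max_eq_right (le_of_lt hs)]; simp
    rw [max_eq_right h.le]
    simpa using (hasDerivAt_const t (0:ℝ)).congr_of_eventuallyEq this
  · subst h
    simp only [max_self, ne_eq, Nat.add_eq_zero_iff, one_ne_zero, and_false, not_false_eq_true,
      zero_pow, mul_zero]
    rw [hasDerivAt_iff_isLittleO]
    simp only [max_self, ne_eq, Nat.add_eq_zero_iff, OfNat.ofNat_ne_zero, and_false,
      not_false_eq_true, zero_pow, sub_zero, smul_zero]
    have h1 : (fun t : ℝ => max t 0 ^ (n + 2)) =O[𝓝 0] fun t => t ^ (n + 2) := by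
      refine Asymptotics.IsBigO.of_bound 1 (Eventually.of_forall fun t => ?_)
      rw [one_mul, norm_pow, norm_pow]
      gcongr
      rw [Real.norm_eq_abs, Real.norm_eq_abs, abs_of_nonneg (le_max_right _ _)]
      exact max_le (le_abs_self t) (abs_nonneg t)
    refine h1.trans_isLittleO ?_
    have := Asymptotics.isLittleO_pow_pow (𝕜 := ℝ) (show 1 < n + 2 by omega)
    simpa using this
  · have : (fun t : ℝ => max t 0 ^ (n + 2)) =ᶠ[𝓝 t] fun t => t ^ (n + 2) := by
      filter_upwards [Ioi_mem_nhds h] with s hs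
      rw [max_eq_left (le_of_lt hs)]
    rw [max_eq_left h.le]
    have h2 := (hasDerivAt_pow (n + 2) t).congr_of_eventuallyEq this
    simpa using h2

lemma contDiff_pospow (n : ℕ) : ContDiff ℝ 2 (fun t : ℝ => max t 0 ^ (n + 3)) := by
  have hd : ∀ m : ℕ, deriv (fun t : ℝ => max t 0 ^ (m + 2)) =
      fun t : ℝ => ((m : ℝ) + 2) * max t 0 ^ (m + 1) :=
    fun m => funext fun t => (hasDerivAt_pospow m t).deriv
  have h1 : ContDiff ℝ 1 (fun t : ℝ => max t 0 ^ (n + 2)) := by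
    rw [contDiff_one_iff_deriv]
    refine ⟨fun t => (hasDerivAt_pospow n t).differentiableAt, ?_⟩
    rw [hd]; fun_prop
  have : (2 : WithTop ℕ∞) = 1 + 1 := by norm_num
  rw [this, contDiff_succ_iff_deriv]
  refine ⟨fun t => (hasDerivAt_pospow (n+1) t).differentiableAt, by simp, ?_⟩
  rw [hd (n+1)]
  exact contDiff_const.mul h1

/-- the bump kernels -/
noncomputable def kk (c : EuclideanSpace ℝ (Fin d)) (s : ℝ) (p : ℕ)
    (x : EuclideanSpace ℝ (Fin d)) : ℝ := max (s ^ 2 - ‖x - c‖ ^ 2) 0 ^ p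

lemma kk_nonneg (c : EuclideanSpace ℝ (Fin d)) (s : ℝ) (p : ℕ) (x) : 0 ≤ kk c s p x :=
  pow_nonneg (le_max_right _ _) _

lemma kk_cont (c : EuclideanSpace ℝ (Fin d)) (s : ℝ) (p : ℕ) : Continuous (kk c s p) := by
  unfold kk; fun_prop

lemma kk_contDiff (c : EuclideanSpace ℝ (Fin d)) (s : ℝ) (p : ℕ) :
    ContDiff ℝ 2 (kk c s (p + 3)) :=
  (contDiff_pospow p).comp (contDiff_const.sub (contDiff_nsq c))

lemma kk_zero (c : EuclideanSpace ℝ (Fin d)) {s : ℝ} (hs : 0 < s) (p : ℕ) {x}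
    (hx : x ∉ closedBall c s) : kk c s (p + 1) x = 0 := by
  have : s < ‖x - c‖ := by simpa [dist_eq_norm] using hx
  unfold kk
  rw [max_eq_right (by nlinarith)]; simp

lemma kk_supp (c : EuclideanSpace ℝ (Fin d)) {s : ℝ} (hs : 0 < s) (p : ℕ) :
    HasCompactSupport (kk c s (p + 1)) :=
  HasCompactSupport.intro (isCompact_closedBall c s) fun _ hx => kk_zero c hs p hx

lemma kk_int (c : EuclideanSpace ℝ (Fin d)) {s : ℝ} (hs : 0 < s) (p : ℕ)
    {R : EuclideanSpace ℝ (Fin d) → ℝ} (hR : Continuous R) :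
    Integrable (fun x => R x * kk c s (p + 1) x) :=
  (hR.mul (kk_cont c s _)).integrable_of_hasCompactSupport ((kk_supp c hs p).mul_left)

lemma kk_succ_le (c : EuclideanSpace ℝ (Fin d)) (s : ℝ) (p : ℕ) (x) :
    kk c s (p + 1) x ≤ s ^ 2 * kk c s p x := by
  unfold kk
  rw [pow_succ, mul_comm]
  gcongr
  refine max_le ?_ (by positivity)
  nlinarith [sq_nonneg ‖x - c‖]

lemma kk_lap (c : EuclideanSpace ℝ (Fin d)) (s : ℝ) (p : ℕ) (x) :
    laplacian (kk c s (p + 3)) x =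
      4 * (p + 3) * (p + 2) * s ^ 2 * kk c s (p + 1) x
        - 2 * (p + 3) * (d + 2 * p + 4) * kk c s (p + 2) x := by
  have hin : ∀ q : ℝ, HasDerivAt (fun q : ℝ => s ^ 2 - q) (-1) q := fun q => by
    simpa using (hasDerivAt_id q).const_sub (s ^ 2)
  have h1 : ∀ q : ℝ, HasDerivAt (fun q : ℝ => max (s ^ 2 - q) 0 ^ (p + 3))
      (-(p + 3) * max (s ^ 2 - q) 0 ^ (p + 2)) q := by
    intro q
    have := (hasDerivAt_pospow (p + 1) (s ^ 2 - q)).comp q (hin q)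
    refine this.congr_deriv ?_
    push_cast; ring
  have h2 : HasDerivAt (fun q : ℝ => -(p + 3 : ℝ) * max (s ^ 2 - q) 0 ^ (p + 2))
      ((p + 3) * (p + 2) * max (s ^ 2 - ‖x - c‖ ^ 2) 0 ^ (p + 1)) (‖x - c‖ ^ 2) := by
    have := ((hasDerivAt_pospow p (s ^ 2 - ‖x - c‖ ^ 2)).comp _ (hin _)).const_mul (-(p + 3 : ℝ))
    refine this.congr_deriv ?_
    ring
  have h3 := laplacian_radial c x (Eventually.of_forall h1) h2
  change laplacian (kk c s (p + 3)) x = _ at h3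
  rw [h3]
  unfold kk
  have : ‖x - c‖ ^ 2 * max (s ^ 2 - ‖x - c‖ ^ 2) 0 ^ (p + 1) =
    (s ^ 2 - max (s ^ 2 - ‖x - c‖ ^ 2) 0) * max (s ^ 2 - ‖x - c‖ ^ 2) 0 ^ (p + 1) := by
    rcases le_total (s ^ 2 - ‖x - c‖ ^ 2) 0 with h | h
    · rw [max_eq_right h]; simp
    · rw [max_eq_left h]; ring
  linear_combination (4 * (p + 3) * (p + 2)) * this

lemma kk_J_pos (c : EuclideanSpace ℝ (Fin d)) {s : ℝ} (hs : 0 < s) (p : ℕ)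
    {R : EuclideanSpace ℝ (Fin d) → ℝ} (hR : Continuous R) (h0 : ∀ x, 0 ≤ R x)
    {z : EuclideanSpace ℝ (Fin d)} (hz : z ∈ ball c s) (hRz : 0 < R z) :
    0 < ∫ x, R x * kk c s (p + 1) x := by
  refine (hR.mul (kk_cont c s _)).integral_pos_of_hasCompactSupport_nonneg_nonzero
    ((kk_supp c hs p).mul_left) (fun x => mul_nonneg (h0 x) (kk_nonneg _ _ _ _)) (x := z) ?_
  have : ‖z - c‖ < s := by simpa [dist_eq_norm] using hz
  refine mul_ne_zero hRz.ne' ?_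
  unfold kk
  have h : 0 < s ^ 2 - ‖z - c‖ ^ 2 := by nlinarith [norm_nonneg (z - c)]
  rw [max_eq_left h.le]
  positivity

lemma kk_lap_int (c : EuclideanSpace ℝ (Fin d)) {s : ℝ} (hs : 0 < s) (p : ℕ)
    {R : EuclideanSpace ℝ (Fin d) → ℝ} (hR : Continuous R) :
    ∫ x, R x * laplacian (kk c s (p + 3)) x =
      4 * (p + 3) * (p + 2) * s ^ 2 * (∫ x, R x * kk c s (p + 1) x)
        - 2 * (p + 3) * (d + 2 * p + 4) * ∫ x, R x * kk c s (p + 2) x := by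
  rw [← integral_const_mul, ← integral_const_mul, ← integral_sub]
  · refine integral_congr_ae (Eventually.of_forall fun x => ?_)
    simp only [kk_lap]; ring
  · exact (kk_int c hs p hR).const_mul _
  · exact (kk_int c hs (p+1) hR).const_mul _

lemma kk_J_rec (c : EuclideanSpace ℝ (Fin d)) {s : ℝ} (hs : 0 < s) (p : ℕ) :
      4 * (p + 3) * (p + 2) * s ^ 2 * (∫ x, (1:ℝ) * kk c s (p + 1) x)
        = 2 * (p + 3) * (d + 2 * p + 4) * ∫ x, (1:ℝ) * kk c s (p + 2) x := by
  have h1 := kk_lap_int c hs p (R := fun _ => 1) continuous_const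
  have h2 := laplacian_ibp (Q := fun _ => (1:ℝ)) contDiff_const (kk_contDiff c s p)
    (kk_supp c hs (p+2))
  rw [h1] at h2
  simp only [laplacian_const, zero_mul, integral_zero] at h2
  linarith

lemma kk_lap_zero (c : EuclideanSpace ℝ (Fin d)) {s : ℝ} (hs : 0 < s) (p : ℕ) :
    ∫ x, laplacian (kk c s (p + 3)) x = 0 := by
  have h2 := laplacian_ibp (Q := fun _ => (1:ℝ)) contDiff_const (kk_contDiff c s p)
    (kk_supp c hs (p+2))
  simpa only [laplacian_const, zero_mul, integral_zero, one_mul] using h2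

lemma kk_tendsto (c : EuclideanSpace ℝ (Fin d)) {s : ℝ} (hs : 0 < s)
    {R : EuclideanSpace ℝ (Fin d) → ℝ} (hR : Continuous R) :
    Tendsto (fun p : ℕ => (∫ x, R x * kk c s (p + 1) x) / ∫ x, (1:ℝ) * kk c s (p + 1) x)
      atTop (𝓝 (R c)) := by
  have h := tendsto_setIntegral_pow_smul_of_unique_maximum_of_isCompact_of_continuousOn
    (μ := (volume : Measure (EuclideanSpace ℝ (Fin d)))) (isCompact_closedBall c s)
    (c := fun x => max (s ^ 2 - ‖x - c‖ ^ 2) 0) (x₀ := c) (g := R)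
    (by fun_prop) ?_ (fun x _ => le_max_right _ _) ?_ ?_ hR.continuousOn
  · have h := h.comp (tendsto_add_atTop_nat 1)
    refine h.congr fun p => ?_
    simp only [Function.comp, smul_eq_mul]
    rw [div_eq_inv_mul]
    congr 1
    · congr 1
      rw [setIntegral_eq_integral_of_forall_compl_eq_zero]
      · simp only [one_mul]; rfl
      · intro x hx; exact kk_zero c hs p hx
    · rw [setIntegral_eq_integral_of_forall_compl_eq_zero]
      · refine integral_congr_ae (Eventually.of_forall fun x => ?_)
        simp only [kk]; ring
      · intro x hx
        have := kk_zero c hs p hx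
        unfold kk at this
        rw [this, zero_mul]
  · intro y _ hne
    have h1 : 0 < ‖y - c‖ := norm_pos_iff.mpr (sub_ne_zero.mpr hne)
    simp only [sub_self, norm_zero]
    have h2 : 0 < s ^ 2 := by positivity
    have h3 : 0 < ‖y - c‖ ^ 2 := by positivity
    rw [max_eq_left (a := s ^ 2 - 0 ^ 2) (by simp; positivity)]
    refine max_lt ?_ ?_ <;> nlinarith
  · simp [hs.ne']
  · refine subset_closure ?_
    exact ball_subset_interior_closedBall (mem_ball_self hs)

lemma prod_bound {t : ℝ} (ht : 0 < t) (n : ℕ) :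
    ∏ j ∈ Finset.range n, (1 + t ^ 2 / ((j : ℝ) + 1) ^ 2) ≤ Real.exp (Real.pi * t) := by
  have h := Complex.tendsto_euler_sin_prod (t * Complex.I)
  have h2 : Tendsto (fun n : ℕ => Real.pi * t * ∏ j ∈ Finset.range n, (1 + t ^ 2 / ((j : ℝ) + 1) ^ 2))
      atTop (𝓝 (Real.sinh (Real.pi * t))) := by
    have h3 := h.mul_const (-Complex.I)
    have h4 : Complex.sin (Real.pi * (t * Complex.I)) * (-Complex.I) =
        ((Real.sinh (Real.pi * t) : ℝ) : ℂ) := by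
      rw [← mul_assoc, Complex.sin_mul_I]
      push_cast
      linear_combination (-Complex.sinh (Real.pi * t)) * Complex.I_sq
    rw [h4] at h3
    rw [← Filter.tendsto_ofReal_iff]
    refine h3.congr fun n => ?_
    have h5 : ∏ j ∈ Finset.range n, ((1:ℂ) - (t * Complex.I) ^ 2 / ((j:ℂ) + 1) ^ 2)
        = ∏ j ∈ Finset.range n, ((1:ℂ) + t ^ 2 / ((j:ℂ) + 1) ^ 2) := by
      refine Finset.prod_congr rfl fun j _ => ?_
      rw [mul_pow, Complex.I_sq]; ring
    rw [h5]
    simp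
    linear_combination (-(Real.pi * t * ∏ j ∈ Finset.range n, ((1:ℂ) + t ^ 2 / ((j:ℂ) + 1) ^ 2))) * Complex.I_sq
  have hp : 0 < Real.pi * t := by positivity
  have hmono : Monotone (fun n : ℕ => Real.pi * t * ∏ j ∈ Finset.range n, (1 + t ^ 2 / ((j : ℝ) + 1) ^ 2)) := by
    refine monotone_nat_of_le_succ fun n => ?_
    rw [Finset.prod_range_succ]
    have hq : 0 ≤ ∏ j ∈ Finset.range n, (1 + t ^ 2 / ((j : ℝ) + 1) ^ 2) :=
      Finset.prod_nonneg fun j _ => by positivity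
    gcongr
    refine le_mul_of_one_le_right hq ?_
    have : 0 ≤ t ^ 2 / ((n : ℝ) + 1) ^ 2 := by positivity
    linarith
  have h6 := hmono.ge_of_tendsto h2 n
  have h7 : Real.sinh (Real.pi * t) ≤ Real.pi * t * Real.exp (Real.pi * t) := by
    rw [Real.sinh_eq]
    set y := Real.pi * t
    have h8 : 1 - 2 * y ≤ Real.exp (-(2 * y)) := by linarith [Real.add_one_le_exp (-(2*y))]
    have h9 : Real.exp (-y) = Real.exp y * Real.exp (-(2 * y)) := by
      rw [← Real.exp_add]; congr 1; ring
    have := mul_le_mul_of_nonneg_left h8 (Real.exp_pos y).le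
    rw [h9]; nlinarith
  exact le_of_mul_le_mul_left (h6.trans h7) hp

/-- weak Harnack -/
lemma weak_harnack (c : EuclideanSpace ℝ (Fin d)) {s ε : ℝ} (hs : 0 < s) (hε : 0 < ε)
    {S : EuclideanSpace ℝ (Fin d) → ℝ} (hS : Continuous S) (h0 : ∀ x, 0 ≤ S x)
    (hw : ∀ p : ℕ, ∫ x, S x * laplacian (kk c s (p + 3)) x ≤
      (1 / ε) * ∫ x, S x * kk c s (p + 3) x) :
    (∫ x, S x * kk c s 1 x) / (∫ x, (1:ℝ) * kk c s 1 x) ≤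
      S c * Real.exp (Real.pi * (s / (2 * √ε))) := by
  set I : ℕ → ℝ := fun p => ∫ x, S x * kk c s (p + 1) x with hI
  set J : ℕ → ℝ := fun p => ∫ x, (1:ℝ) * kk c s (p + 1) x with hJ
  have hJp : ∀ p, 0 < J p := fun p => kk_J_pos c hs p continuous_const (fun _ => zero_le_one)
    (mem_ball_self hs) zero_lt_one
  have hI0 : ∀ p, 0 ≤ I p := fun p =>
    integral_nonneg fun x => mul_nonneg (h0 x) (kk_nonneg _ _ _ _)
  set t := s / (2 * √ε) with ht
  have htp : 0 < t := by positivity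
  have ht2 : s ^ 2 / ε = 4 * t ^ 2 := by
    rw [ht, div_pow, mul_pow, Real.sq_sqrt hε.le]; field_simp; norm_num
  have step : ∀ p : ℕ, I p / J p ≤ I (p + 1) / J (p + 1) * (1 + t ^ 2 / ((p : ℝ) + 1) ^ 2) := by
    intro p
    have h1 := hw p
    rw [kk_lap_int c hs p hS] at h1
    have h2 : ∫ x, S x * kk c s (p + 3) x ≤ s ^ 2 * I (p + 1) := by
      rw [hI]
      simp only
      rw [← integral_const_mul]
      refine integral_mono (kk_int c hs (p + 2) hS) ((kk_int c hs (p + 1) hS).const_mul _) fun x => ?_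
      have := mul_le_mul_of_nonneg_left (kk_succ_le c s (p + 2) x) (h0 x)
      simp only
      linarith
    have h3 : (1 / ε) * ∫ x, S x * kk c s (p + 3) x ≤ 4 * t ^ 2 * I (p + 1) := by
      calc _ ≤ (1 / ε) * (s ^ 2 * I (p + 1)) := by gcongr
        _ = (s ^ 2 / ε) * I (p + 1) := by ring
        _ = _ := by rw [ht2]
    have h4 := kk_J_rec c hs p
    set lam : ℝ := 4 * (p + 3) * (p + 2) * s ^ 2 with hlam
    set β : ℝ := 2 * (p + 3) * (d + 2 * p + 4) with hβ
    have hlp : 0 < lam := by positivity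
    have hβp : 4 * ((p : ℝ) + 1) ^ 2 ≤ β := by
      have : (0:ℝ) ≤ d := by positivity
      have hp : (0:ℝ) ≤ p := by positivity
      nlinarith [mul_nonneg hp this]
    have h5 : lam * I p ≤ (β + 4 * t ^ 2) * I (p + 1) := by
      change lam * I p - β * I (p + 1) ≤ _ at h1
      linarith
    change lam * J p = β * J (p + 1) at h4
    have h6 : β + 4 * t ^ 2 ≤ β * (1 + t ^ 2 / ((p : ℝ) + 1) ^ 2) := by
      have : 4 * t ^ 2 ≤ β * (t ^ 2 / ((p : ℝ) + 1) ^ 2) := by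
        calc 4 * t ^ 2 = 4 * ((p : ℝ) + 1) ^ 2 * (t ^ 2 / ((p : ℝ) + 1) ^ 2) := by field_simp
          _ ≤ _ := by gcongr
      linarith
    rw [div_mul_eq_mul_div, div_le_div_iff₀ (hJp _) (hJp _)]
    set X := 1 + t ^ 2 / ((p : ℝ) + 1) ^ 2
    have h7 : lam * I p ≤ β * X * I (p + 1) := h5.trans (by gcongr; exact hI0 _)
    have h8 : lam * (I p * J (p + 1)) ≤ lam * (I (p + 1) * X * J p) := by
      calc lam * (I p * J (p + 1)) = (lam * I p) * J (p + 1) := by ring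
        _ ≤ (β * X * I (p + 1)) * J (p + 1) := by gcongr; exact (hJp _).le
        _ = I (p + 1) * X * (β * J (p + 1)) := by ring
        _ = _ := by rw [← h4]; ring
    exact le_of_mul_le_mul_left h8 hlp
  have iter : ∀ n : ℕ, I 0 / J 0 ≤ I n / J n * ∏ j ∈ Finset.range n, (1 + t ^ 2 / ((j : ℝ) + 1) ^ 2) := by
    intro n
    induction n with
    | zero => simp
    | succ n ih =>
      rw [Finset.prod_range_succ]
      have hq : 0 ≤ ∏ j ∈ Finset.range n, (1 + t ^ 2 / ((j : ℝ) + 1) ^ 2) :=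
        Finset.prod_nonneg fun j _ => by positivity
      calc _ ≤ _ := ih
        _ ≤ (I (n + 1) / J (n + 1) * (1 + t ^ 2 / ((n : ℝ) + 1) ^ 2)) * ∏ j ∈ Finset.range n, (1 + t ^ 2 / ((j : ℝ) + 1) ^ 2) := by
          gcongr; exact step n
        _ = _ := by ring
  have hlim := (kk_tendsto c hs hS).mul_const (Real.exp (Real.pi * t))
  refine ge_of_tendsto' hlim fun n => ?_
  refine (iter n).trans ?_
  have : 0 ≤ I n / J n := div_nonneg (hI0 n) (hJp n).le
  exact mul_le_mul_of_nonneg_left (prod_bound htp n) this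

/-- existence of a kernel detecting a strict nonconstant minimum -/
lemma exists_kernel (c : EuclideanSpace ℝ (Fin d)) {s : ℝ} (hs : 0 < s)
    {R : EuclideanSpace ℝ (Fin d) → ℝ} (hR : Continuous R) (h0 : ∀ x, 0 ≤ R x) (hc : R c = 0)
    {z : EuclideanSpace ℝ (Fin d)} (hz : z ∈ ball c s) (hRz : 0 < R z) :
    ∃ p : ℕ, 0 < ∫ x, R x * laplacian (kk c s (p + 3)) x := by
  by_contra! hcon
  set I : ℕ → ℝ := fun p => ∫ x, R x * kk c s (p + 1) x with hI
  set J : ℕ → ℝ := fun p => ∫ x, (1:ℝ) * kk c s (p + 1) x with hJ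
  have hJp : ∀ p, 0 < J p := fun p => kk_J_pos c hs p continuous_const (fun _ => zero_le_one)
    (mem_ball_self hs) zero_lt_one
  have hmono : Monotone (fun p => I p / J p) := by
    refine monotone_nat_of_le_succ fun p => ?_
    have h1 := hcon p
    rw [kk_lap_int c hs p hR] at h1
    have h4 := kk_J_rec c hs p
    set lam : ℝ := 4 * (p + 3) * (p + 2) * s ^ 2 with hlam
    set β : ℝ := 2 * (p + 3) * (d + 2 * p + 4) with hβ
    have hlp : 0 < lam := by positivity
    change lam * J p = β * J (p + 1) at h4
    change lam * I p - β * I (p + 1) ≤ _ at h1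
    rw [div_le_div_iff₀ (hJp _) (hJp _)]
    have h8 : lam * (I p * J (p + 1)) ≤ lam * (I (p + 1) * J p) := by
      calc lam * (I p * J (p + 1)) = (lam * I p) * J (p + 1) := by ring
        _ ≤ (β * I (p + 1)) * J (p + 1) := by
          exact mul_le_mul_of_nonneg_right (by linarith) (hJp _).le
        _ = I (p + 1) * (β * J (p + 1)) := by ring
        _ = _ := by rw [← h4]; ring
    exact le_of_mul_le_mul_left h8 hlp
  have h2 := hmono.ge_of_tendsto (kk_tendsto c hs hR) 0
  rw [hc] at h2
  have h3 : 0 < I 0 / J 0 := div_pos (kk_J_pos c hs 0 hR h0 hz hRz) (hJp 0)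
  exact absurd h2 (not_le.mpr h3)

end kernels

section pde
variable {d : ℕ}

lemma weak_cube {O : Set (EuclideanSpace ℝ (Fin d))}
    {F f k : EuclideanSpace ℝ (Fin d) → ℝ} (hF : Continuous F) (hoff : ∀ x ∉ O, F x = 0)
    (hC2 : ∀ x ∈ O, ContDiffAt ℝ 2 F x) (hF1 : ∀ x, F x ≤ 1)
    (hf : Continuous f) (hf0 : ∀ x, 0 ≤ f x) (hlap : ∀ x ∈ O, - f x ≤ laplacian F x)
    (hk : ContDiff ℝ 2 k) (hkc : HasCompactSupport k) (hk0 : ∀ x, 0 ≤ k x) :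
    -3 * ∫ x, max (F x) 0 ^ 2 * f x * k x ≤ ∫ x, max (F x) 0 ^ 3 * laplacian k x := by
  have hlk : Continuous (laplacian k) := laplacian_continuous hk
  have hlks : HasCompactSupport (laplacian k) := by
    refine HasCompactSupport.intro hkc fun x hx => ?_
    have : k =ᶠ[𝓝 x] fun _ => 0 := by
      have := (isClosed_tsupport k).isOpen_compl.mem_nhds hx
      filter_upwards [this] with y hy
      exact image_eq_zero_of_notMem_tsupport hy
    rw [laplacian_congr this, laplacian_const]
  set C := ∫ x, |laplacian k x| with hC
  have hC0 : 0 ≤ C := integral_nonneg fun x => abs_nonneg _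
  have main : ∀ δ > 0, -3 * ∫ x, max (F x) 0 ^ 2 * f x * k x ≤
      (∫ x, max (F x) 0 ^ 3 * laplacian k x) + 3 * δ * C := by
    intro δ hδ
    set Q : EuclideanSpace ℝ (Fin d) → ℝ := fun x => max (F x - δ) 0 ^ 3 with hQ
    have hoffQ : ∀ x ∉ O, Q =ᶠ[𝓝 x] fun _ => 0 := by
      intro x hx
      have : ∀ᶠ y in 𝓝 x, F y < δ :=
        hF.continuousAt.eventually_lt continuousAt_const (by rw [hoff x hx]; exact hδ)
      filter_upwards [this] with y hy
      rw [hQ]; simp only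
      rw [max_eq_right (by linarith)]; simp
    have hQC : ContDiff ℝ 2 Q := by
      rw [contDiff_iff_contDiffAt]
      intro x
      by_cases hx : x ∈ O
      · exact ContDiffAt.comp x (contDiff_pospow 0).contDiffAt ((hC2 x hx).sub contDiffAt_const)
      · exact contDiffAt_const.congr_of_eventuallyEq (hoffQ x hx)
    have hQl : ∀ x, -3 * (max (F x) 0 ^ 2 * f x) ≤ laplacian Q x := by
      intro x
      by_cases hx : x ∈ O
      · have hin : ∀ q : ℝ, HasDerivAt (fun q : ℝ => q - δ) 1 q := fun q => by
          simpa using (hasDerivAt_id q).sub_const δ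
        have h1 : ∀ q : ℝ, HasDerivAt (fun q : ℝ => max (q - δ) 0 ^ 3)
            (3 * max (q - δ) 0 ^ 2) q := by
          intro q
          have := (hasDerivAt_pospow 1 (q - δ)).comp q (hin q)
          refine this.congr_deriv ?_
          push_cast; ring
        have h2 : HasDerivAt (fun q : ℝ => 3 * max (q - δ) 0 ^ 2)
            (6 * max (F x - δ) 0) (F x) := by
          have := (HasDerivAt.comp (F x) (h₂ := fun t : ℝ => max t 0 ^ (0 + 2)) (h := fun q : ℝ => q - δ)
            (hasDerivAt_pospow 0 (F x - δ)) (hin (F x))).const_mul 3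
          refine this.congr_deriv ?_
          push_cast; ring
        have h3 := laplacian_comp (hC2 x hx) (Eventually.of_forall h1) h2
        change laplacian Q x = _ at h3
        rw [h3]
        have h4 : 0 ≤ 6 * max (F x - δ) 0 * ∑ i : Fin d, (fderiv ℝ F x (EuclideanSpace.single i 1)) ^ 2 :=
          mul_nonneg (mul_nonneg (by norm_num) (le_max_right _ _))
            (Finset.sum_nonneg fun i _ => sq_nonneg _)
        have h5 : max (F x - δ) 0 ^ 2 ≤ max (F x) 0 ^ 2 := by
          gcongr; linarith
        have h6 := mul_le_mul_of_nonneg_right h5 (hf0 x)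
        have h7 := mul_le_mul_of_nonneg_left (hlap x hx) (sq_nonneg (max (F x - δ) 0))
        nlinarith
      · rw [laplacian_congr (hoffQ x hx), laplacian_const, hoff x hx]; simp
    have i1 : Integrable (fun x => max (F x) 0 ^ 2 * f x * k x) :=
      Continuous.integrable_of_hasCompactSupport (by have := hk.continuous; fun_prop) hkc.mul_left
    have i2 : Integrable (fun x => laplacian Q x * k x) :=
      ((laplacian_continuous hQC).mul hk.continuous).integrable_of_hasCompactSupport hkc.mul_left
    have i3 : Integrable (fun x => Q x * laplacian k x) :=
      (hQC.continuous.mul hlk).integrable_of_hasCompactSupport hlks.mul_left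
    have i4 : Integrable (fun x => max (F x) 0 ^ 3 * laplacian k x) :=
      Continuous.integrable_of_hasCompactSupport (by fun_prop) hlks.mul_left
    have i5 : Integrable (fun x => |laplacian k x|) :=
      (hlk.integrable_of_hasCompactSupport hlks).abs
    calc -3 * ∫ x, max (F x) 0 ^ 2 * f x * k x
        = ∫ x, -3 * (max (F x) 0 ^ 2 * f x * k x) := by rw [integral_const_mul]
      _ ≤ ∫ x, laplacian Q x * k x := by
        refine integral_mono (i1.const_mul _) i2 fun x => ?_
        have := mul_le_mul_of_nonneg_right (hQl x) (hk0 x)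
        simp only; linarith
      _ = ∫ x, Q x * laplacian k x := (laplacian_ibp hQC hk hkc).symm
      _ ≤ ∫ x, (max (F x) 0 ^ 3 * laplacian k x + 3 * δ * |laplacian k x|) := by
        refine integral_mono i3 (i4.add (i5.const_mul _)) fun x => ?_
        simp only [hQ]
        have ha : max (F x - δ) 0 ≤ max (F x) 0 := by gcongr; linarith
        have hb : max (F x) 0 - δ ≤ max (F x - δ) 0 := by
          rcases le_total (F x) 0 with h | h
          · rw [max_eq_right h]; have := le_max_right (F x - δ) 0; linarith
          · rw [max_eq_left h]; exact le_max_left _ _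
        have hc : max (F x) 0 ≤ 1 := max_le (hF1 x) zero_le_one
        have hd : 0 ≤ max (F x - δ) 0 := le_max_right _ _
        set a := max (F x - δ) 0
        set b := max (F x) 0
        have h1 : a ^ 3 ≤ b ^ 3 := by gcongr
        have h2 : b ^ 3 - a ^ 3 ≤ 3 * δ := by
          have e : b ^ 3 - a ^ 3 = (b - a) * (b ^ 2 + a * b + a ^ 2) := by ring
          have e2 : b ^ 2 + a * b + a ^ 2 ≤ 3 := by nlinarith
          have e3 : 0 ≤ b ^ 2 + a * b + a ^ 2 := by positivity
          rw [e]
          calc _ ≤ δ * (b ^ 2 + a * b + a ^ 2) := by gcongr; linarith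
            _ ≤ δ * 3 := by gcongr
            _ = _ := by ring
        have h3 : (a ^ 3 - b ^ 3) * laplacian k x ≤ 3 * δ * |laplacian k x| := by
          calc _ ≤ |(a ^ 3 - b ^ 3) * laplacian k x| := le_abs_self _
            _ = |a ^ 3 - b ^ 3| * |laplacian k x| := abs_mul _ _
            _ ≤ _ := by
              gcongr
              rw [abs_le]; constructor <;> linarith
        linarith
      _ = _ := by rw [integral_add i4 (i5.const_mul _), integral_const_mul]
  refine le_of_forall_pos_le_add fun e he => ?_
  refine (main (e / (3 * C + 1)) (by positivity)).trans ?_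
  gcongr
  rw [mul_comm 3, mul_assoc, div_mul_eq_mul_div, div_le_iff₀ (by positivity)]
  nlinarith

structure Sol (O : Set (EuclideanSpace ℝ (Fin d))) (ε : ℝ) (U : EuclideanSpace ℝ (Fin d) → ℝ) :
    Prop where
  eps : 0 < ε
  cont : Continuous U
  c2 : ∀ x ∈ O, ContDiffAt ℝ 2 U x
  off : ∀ x ∉ O, U x = 0
  pos : ∀ x ∈ O, 0 < U x
  lt_one : ∀ x ∈ O, U x < 1
  lap : ∀ x ∈ O, laplacian U x = (U x - 1) / ε

namespace Sol
variable {O : Set (EuclideanSpace ℝ (Fin d))} {ε : ℝ} {U : EuclideanSpace ℝ (Fin d) → ℝ}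

lemma nonneg (h : Sol O ε U) (x) : 0 ≤ U x := by
  by_cases hx : x ∈ O
  · exact (h.pos x hx).le
  · rw [h.off x hx]

lemma lt_one' (h : Sol O ε U) (x) : U x < 1 := by
  by_cases hx : x ∈ O
  · exact h.lt_one x hx
  · rw [h.off x hx]; exact zero_lt_one

lemma weak (h : Sol O ε U) (c : EuclideanSpace ℝ (Fin d)) {s : ℝ} (hs : 0 < s) (p : ℕ) :
    ∫ x, (1 - U x ^ 3) * laplacian (kk c s (p + 3)) x ≤
      (1 / ε) * ∫ x, (1 - U x ^ 3) * kk c s (p + 3) x := by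
  have hc := h.cont
  have he := h.eps
  have h1 := weak_cube (f := fun x => (1 - U x) / ε) h.cont h.off h.c2 (fun x => (h.lt_one' x).le)
    (by fun_prop) (fun x => div_nonneg (by linarith [h.lt_one' x]) he.le)
    (fun x hx => by rw [h.lap x hx]; apply le_of_eq; ring) (kk_contDiff c s p) (kk_supp c hs (p + 2))
    (kk_nonneg c s _)
  simp only [max_eq_left (h.nonneg _)] at h1
  have hlk : Continuous (laplacian (kk c s (p + 3))) := laplacian_continuous (kk_contDiff c s p)
  have hlks : HasCompactSupport (laplacian (kk c s (p + 3))) := by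
    have : laplacian (kk c s (p + 3)) = fun x => 4 * (p + 3) * (p + 2) * s ^ 2 * kk c s (p + 1) x
        - 2 * (p + 3) * (d + 2 * p + 4) * kk c s (p + 2) x := funext (kk_lap c s p)
    rw [this]
    exact HasCompactSupport.sub (kk_supp c hs p).mul_left (kk_supp c hs (p + 1)).mul_left
  have i1 : Integrable (laplacian (kk c s (p + 3))) := hlk.integrable_of_hasCompactSupport hlks
  have i2 : Integrable (fun x => U x ^ 3 * laplacian (kk c s (p + 3)) x) :=
    Continuous.integrable_of_hasCompactSupport (by fun_prop) hlks.mul_left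
  have e1 : ∫ x, (1 - U x ^ 3) * laplacian (kk c s (p + 3)) x =
      - ∫ x, U x ^ 3 * laplacian (kk c s (p + 3)) x := by
    simp only [sub_mul, one_mul]
    rw [integral_sub i1 i2, kk_lap_zero c hs p, zero_sub]
  have i3 := kk_int c hs (p + 2) (R := fun x => U x ^ 2 * ((1 - U x) / ε)) (by fun_prop)
  have i4 := kk_int c hs (p + 2) (R := fun x => 1 - U x ^ 3) (by fun_prop)
  have e2 : 3 * ∫ x, U x ^ 2 * ((1 - U x) / ε) * kk c s (p + 3) x ≤
      (1 / ε) * ∫ x, (1 - U x ^ 3) * kk c s (p + 3) x := by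
    rw [← integral_const_mul, ← integral_const_mul]
    refine integral_mono (i3.const_mul _) (i4.const_mul _) fun x => ?_
    simp only
    have := h.nonneg x
    have h2 := h.lt_one' x
    have h3 : 3 * (U x ^ 2 * (1 - U x)) ≤ 1 - U x ^ 3 := by
      nlinarith [mul_nonneg (sub_nonneg.mpr h2.le) (sq_nonneg (1 - U x)),
        mul_nonneg (sub_nonneg.mpr h2.le) this]
    have h4 : 0 ≤ (1 / ε) * kk c s (p + 3) x := mul_nonneg (by positivity) (kk_nonneg _ _ _ _)
    have h5 := mul_le_mul_of_nonneg_right h3 h4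
    calc _ = 3 * (U x ^ 2 * (1 - U x)) * (1 / ε * kk c s (p + 3) x) := by ring
      _ ≤ _ := h5
      _ = _ := by ring
  rw [e1]
  linarith

lemma kk_le_one (c : EuclideanSpace ℝ (Fin d)) (s : ℝ) (p : ℕ) (x) :
    kk c s (p + 1) x ≤ (s ^ 2) ^ p * kk c s 1 x := by
  induction p with
  | zero => simp
  | succ p ih =>
    calc _ ≤ s ^ 2 * kk c s (p + 1) x := kk_succ_le c s (p + 1) x
      _ ≤ s ^ 2 * ((s ^ 2) ^ p * kk c s 1 x) := by gcongr
      _ = _ := by ring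

lemma avg {ε₀ : ℝ} {U₀ : EuclideanSpace ℝ (Fin d) → ℝ} (h₀ : Sol O ε₀ U₀) (hO : IsOpen O)
    {y : EuclideanSpace ℝ (Fin d)} (hy : y ∈ frontier O) {s : ℝ} (hs : 0 < s) :
    ∃ c > 0, ∀ ε U, ε ≤ 1 → Sol O ε U → c * ε ≤ ∫ x, (1 - U x) * kk y s 1 x := by
  have hyO : y ∉ O := by rw [hO.frontier_eq] at hy; exact hy.2
  have hycl : y ∈ closure O := frontier_subset_closure hy
  obtain ⟨z, hzO, hz⟩ := Metric.mem_closure_iff.mp hycl s hs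
  have hcU₀ := h₀.cont
  have hR1 : ∀ x, 0 ≤ 1 - (1 - U₀ x) ^ 3 := fun x => by
    have := h₀.nonneg x
    have := h₀.lt_one' x
    have : (1 - U₀ x) ^ 3 ≤ 1 := pow_le_one₀ (by linarith) (by linarith)
    linarith
  obtain ⟨p, hp⟩ := exists_kernel y hs (R := fun x => 1 - (1 - U₀ x) ^ 3) (by fun_prop)
    hR1 (by simp [h₀.off y hyO]) (z := z) (by rw [mem_ball']; exact hz) (by
      have h1 := h₀.pos z hzO
      have h2 := h₀.lt_one' z
      have : (1 - U₀ z) ^ 3 < 1 := pow_lt_one₀ (by linarith) (by linarith) (by norm_num)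
      linarith)
  set c0 := ∫ x, (1 - (1 - U₀ x) ^ 3) * laplacian (kk y s (p + 3)) x with hc0
  have hlk : Continuous (laplacian (kk y s (p + 3))) := laplacian_continuous (kk_contDiff y s p)
  have hlks : HasCompactSupport (laplacian (kk y s (p + 3))) := by
    have : laplacian (kk y s (p + 3)) = fun x => 4 * (p + 3) * (p + 2) * s ^ 2 * kk y s (p + 1) x
        - 2 * (p + 3) * (d + 2 * p + 4) * kk y s (p + 2) x := funext (kk_lap y s p)
    rw [this]
    exact HasCompactSupport.sub (kk_supp y hs p).mul_left (kk_supp y hs (p + 1)).mul_left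
  obtain ⟨C, hC0, hC⟩ : ∃ C : ℝ, 0 < C ∧ ∀ x, |laplacian (kk y s (p + 3)) x| ≤ C * kk y s 1 x := by
    refine ⟨4 * (p + 3) * (p + 2) * s ^ 2 * (s ^ 2) ^ p
      + 2 * (p + 3) * (d + 2 * p + 4) * (s ^ 2) ^ (p + 1), by positivity, fun x => ?_⟩
    rw [kk_lap]
    have h1 := kk_le_one y s p x
    have h2 := kk_le_one y s (p + 1) x
    have h3 := kk_nonneg y s (p + 1) x
    have h4 := kk_nonneg y s (p + 2) x
    calc _ ≤ |4 * (p + 3) * (p + 2) * s ^ 2 * kk y s (p + 1) x|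
        + |2 * (p + 3) * (d + 2 * p + 4) * kk y s (p + 2) x| := abs_sub _ _
      _ = 4 * (p + 3) * (p + 2) * s ^ 2 * kk y s (p + 1) x
        + 2 * (p + 3) * (d + 2 * p + 4) * kk y s (p + 2) x := by
          rw [abs_of_nonneg (by positivity), abs_of_nonneg (by positivity)]
      _ ≤ 4 * (p + 3) * (p + 2) * s ^ 2 * ((s ^ 2) ^ p * kk y s 1 x)
        + 2 * (p + 3) * (d + 2 * p + 4) * ((s ^ 2) ^ (p + 1) * kk y s 1 x) := by gcongr
      _ = _ := by ring
  set B := 3 * C + 3 * (s ^ 2) ^ (p + 2) with hB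
  have hBp : 0 < B := by positivity
  refine ⟨c0 / B, div_pos hp hBp, fun ε U hε1 h => ?_⟩
  have he := h.eps
  have hcU := h.cont
  have h1 := weak_cube (F := fun x => U x - U₀ x) (f := fun x => (1 - U x) / ε) (O := O)
    (by fun_prop)
    (fun x hx => by simp [h.off x hx, h₀.off x hx])
    (fun x hx => (h.c2 x hx).sub (h₀.c2 x hx))
    (fun x => by linarith [h.lt_one' x, h₀.nonneg x])
    (by fun_prop) (fun x => div_nonneg (by linarith [h.lt_one' x]) he.le)
    (fun x hx => by
      rw [laplacian_sub (h.c2 x hx) (h₀.c2 x hx), h.lap x hx, h₀.lap x hx]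
      have : 0 ≤ (1 - U₀ x) / ε₀ := div_nonneg (by linarith [h₀.lt_one' x]) h₀.eps.le
      have e1 : (U₀ x - 1) / ε₀ = - ((1 - U₀ x) / ε₀) := by ring
      have e2 : (U x - 1) / ε = - ((1 - U x) / ε) := by ring
      rw [e1, e2]; linarith) (kk_contDiff y s p) (kk_supp y hs (p + 2))
    (kk_nonneg y s _)
  have i0 := kk_int y hs 0 (R := fun x => 1 - U x) (by fun_prop)
  simp only [zero_add] at i0
  have j1 : ∫ x, max (U x - U₀ x) 0 ^ 2 * ((1 - U x) / ε) * kk y s (p + 3) x ≤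
      ((s ^ 2) ^ (p + 2) / ε) * ∫ x, (1 - U x) * kk y s 1 x := by
    rw [← integral_const_mul]
    refine integral_mono (kk_int y hs (p + 2) (R := fun x => max (U x - U₀ x) 0 ^ 2 * ((1 - U x) / ε))
      (by fun_prop)) (i0.const_mul _) fun x => ?_
    simp only
    have a1 := h.lt_one' x
    have a2 := h₀.nonneg x
    have a3 : max (U x - U₀ x) 0 ^ 2 ≤ 1 :=
      pow_le_one₀ (le_max_right _ _) (max_le (by linarith) zero_le_one)
    have a4 := kk_le_one y s (p + 2) x
    have a5 := kk_nonneg y s (p + 3) x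
    have a6 : 0 ≤ (1 - U x) / ε := div_nonneg (by linarith) he.le
    calc _ ≤ 1 * ((1 - U x) / ε) * ((s ^ 2) ^ (p + 2) * kk y s 1 x) := by gcongr
      _ = _ := by ring
  have i1 : Integrable (laplacian (kk y s (p + 3))) := hlk.integrable_of_hasCompactSupport hlks
  have i2 : Integrable (fun x => (1 - (1 - U₀ x) ^ 3) * laplacian (kk y s (p + 3)) x) :=
    Continuous.integrable_of_hasCompactSupport (by fun_prop) hlks.mul_left
  have i3 : Integrable (fun x => max (U x - U₀ x) 0 ^ 3 * laplacian (kk y s (p + 3)) x) :=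
    Continuous.integrable_of_hasCompactSupport (by fun_prop) hlks.mul_left
  have i12 : Integrable (fun x => laplacian (kk y s (p + 3)) x
      - (1 - (1 - U₀ x) ^ 3) * laplacian (kk y s (p + 3)) x) := i1.sub i2
  have j2 : ∫ x, max (U x - U₀ x) 0 ^ 3 * laplacian (kk y s (p + 3)) x ≤
      - c0 + 3 * C * ∫ x, (1 - U x) * kk y s 1 x := by
    have : ∫ x, (laplacian (kk y s (p + 3)) x - (1 - (1 - U₀ x) ^ 3) * laplacian (kk y s (p + 3)) x
        + 3 * C * ((1 - U x) * kk y s 1 x)) = - c0 + 3 * C * ∫ x, (1 - U x) * kk y s 1 x := by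
      rw [integral_add i12 (i0.const_mul _), integral_sub i1 i2, kk_lap_zero y hs p,
        integral_const_mul]
      ring
    rw [← this]
    refine integral_mono i3 (i12.add (i0.const_mul _)) fun x => ?_
    simp only
    have a1 := h.lt_one' x
    have a2 := h₀.nonneg x
    have a3 := h.nonneg x
    have a4 := h₀.lt_one' x
    set a := max (U x - U₀ x) 0
    set b := 1 - U₀ x with hb
    have b0 : 0 ≤ a := le_max_right _ _
    have b1 : a ≤ b := max_le (by linarith) (by linarith)
    have b2 : b - a ≤ 1 - U x := by
      have : U x - U₀ x ≤ a := le_max_left _ _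
      linarith
    have b3 : b ≤ 1 := by linarith
    have h1 : a ^ 3 ≤ b ^ 3 := by gcongr
    have h2 : b ^ 3 - a ^ 3 ≤ 3 * (1 - U x) := by
      have e : b ^ 3 - a ^ 3 = (b - a) * (b ^ 2 + a * b + a ^ 2) := by ring
      have e2 : b ^ 2 + a * b + a ^ 2 ≤ 3 := by nlinarith
      rw [e]
      calc _ ≤ (b - a) * 3 := by gcongr
        _ ≤ _ := by linarith
    have h3 : (a ^ 3 - b ^ 3) * laplacian (kk y s (p + 3)) x ≤ 3 * C * ((1 - U x) * kk y s 1 x) := by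
      calc _ ≤ |(a ^ 3 - b ^ 3) * laplacian (kk y s (p + 3)) x| := le_abs_self _
        _ = |a ^ 3 - b ^ 3| * |laplacian (kk y s (p + 3)) x| := abs_mul _ _
        _ ≤ (3 * (1 - U x)) * (C * kk y s 1 x) := by
          refine mul_le_mul ?_ (hC x) (abs_nonneg _) (by linarith)
          rw [abs_le]; constructor <;> linarith
        _ = _ := by ring
    linarith
  set A := ∫ x, (1 - U x) * kk y s 1 x with hA
  have hA0 : 0 ≤ A := integral_nonneg fun x =>
    mul_nonneg (by linarith [h.lt_one' x]) (kk_nonneg _ _ _ _)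
  have fin1 : c0 ≤ 3 * C * A + 3 * ((s ^ 2) ^ (p + 2) / ε * A) := by linarith
  have fin2 : c0 * ε ≤ B * A := by
    calc c0 * ε ≤ (3 * C * A + 3 * ((s ^ 2) ^ (p + 2) / ε * A)) * ε := by gcongr
      _ = 3 * C * A * ε + 3 * ((s ^ 2) ^ (p + 2)) * A := by field_simp
      _ ≤ 3 * C * A * 1 + 3 * ((s ^ 2) ^ (p + 2)) * A := by gcongr
      _ = _ := by rw [hB]; ring
  rw [div_mul_eq_mul_div, div_le_iff₀ hBp]
  linarith

lemma near_bdry {ε₀ : ℝ} {U₀ : EuclideanSpace ℝ (Fin d) → ℝ} (h₀ : Sol O ε₀ U₀) (hO : IsOpen O)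
    {y : EuclideanSpace ℝ (Fin d)} (hy : y ∈ frontier O) {s : ℝ} (hs : 0 < s) :
    ∃ c > 0, ∀ ε U, ε ≤ 1 → Sol O ε U → ∀ x ∈ closedBall y s,
      c * ε * Real.exp (-(5 * s / √ε)) ≤ 1 - U x := by
  obtain ⟨c, hc, H⟩ := avg h₀ hO hy hs
  set J' := ∫ x, (1:ℝ) * kk y (6 * s) 1 x with hJ'
  have hs3 : 0 < 3 * s := by positivity
  have hs6 : 0 < 6 * s := by positivity
  have hJ'p : 0 < J' := kk_J_pos y hs6 0 continuous_const (fun _ => zero_le_one)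
    (mem_ball_self hs6) zero_lt_one
  refine ⟨c / (3 * J'), by positivity, fun ε U hε1 h x0 hx0 => ?_⟩
  have he := h.eps
  have hcU := h.cont
  have hx0' : ‖x0 - y‖ ≤ s := by simpa [dist_eq_norm] using hx0
  have hS0 : ∀ x, 0 ≤ 1 - U x ^ 3 := fun x => by
    have := pow_le_one₀ (h.nonneg x) (h.lt_one' x).le (n := 3)
    linarith
  have h1 := weak_harnack x0 hs3 he (S := fun x => 1 - U x ^ 3) (by fun_prop) hS0
    (fun p => h.weak x0 hs3 p)
  have i1 := kk_int x0 hs3 0 (R := fun x => 1 - U x ^ 3) (by fun_prop)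
  have i2 := kk_int y hs 0 (R := fun x => 1 - U x) (by fun_prop)
  have i3 := kk_int x0 hs3 0 (R := fun x => (1:ℝ)) (by fun_prop)
  have i4 := kk_int y hs6 0 (R := fun x => (1:ℝ)) (by fun_prop)
  simp only [zero_add] at i1 i2 i3 i4
  have n1 : ∀ x, kk y s 1 x ≤ kk x0 (3 * s) 1 x := by
    intro x
    simp only [kk, pow_one]
    refine max_le ?_ (le_max_right _ _)
    rcases le_total ‖x - y‖ s with hx | hx
    · refine le_max_of_le_left ?_
      have : ‖x - x0‖ ≤ 2 * s := by
        have := norm_sub_le_norm_sub_add_norm_sub x y x0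
        rw [norm_sub_rev y x0] at this
        linarith
      nlinarith [norm_nonneg (x - x0), norm_nonneg (x - y)]
    · refine le_max_of_le_right ?_
      nlinarith
  have n2 : ∀ x, kk x0 (3 * s) 1 x ≤ kk y (6 * s) 1 x := by
    intro x
    simp only [kk, pow_one]
    refine max_le ?_ (le_max_right _ _)
    rcases le_total ‖x - x0‖ (3 * s) with hx | hx
    · refine le_max_of_le_left ?_
      have : ‖x - y‖ ≤ 4 * s := by
        have := norm_sub_le_norm_sub_add_norm_sub x x0 y
        linarith
      nlinarith [norm_nonneg (x - x0), norm_nonneg (x - y)]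
    · refine le_max_of_le_right ?_
      nlinarith
  have m1 : c * ε ≤ ∫ x, (1 - U x ^ 3) * kk x0 (3 * s) 1 x := by
    refine (H ε U hε1 h).trans (integral_mono i2 i1 fun x => ?_)
    simp only
    have a1 := h.nonneg x
    have a2 := h.lt_one' x
    have a3 : U x ^ 3 ≤ U x := pow_le_of_le_one a1 a2.le (by norm_num)
    have a4 := kk_nonneg y s 1 x
    exact mul_le_mul (by linarith) (n1 x) a4 (hS0 x)
  have m2 : ∫ x, (1:ℝ) * kk x0 (3 * s) 1 x ≤ J' := by
    refine integral_mono i3 i4 fun x => ?_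
    simpa using n2 x
  have m3 : 0 < ∫ x, (1:ℝ) * kk x0 (3 * s) 1 x := kk_J_pos x0 hs3 0 continuous_const
    (fun _ => zero_le_one) (mem_ball_self hs3) zero_lt_one
  have m4 : c * ε / J' ≤ (1 - U x0 ^ 3) * Real.exp (Real.pi * (3 * s / (2 * √ε))) := by
    refine le_trans ?_ h1
    gcongr
    exact integral_nonneg fun x => mul_nonneg (hS0 x) (kk_nonneg _ _ _ _)
  have m5 : Real.exp (Real.pi * (3 * s / (2 * √ε))) ≤ Real.exp (5 * s / √ε) := by
    apply Real.exp_le_exp.mpr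
    have hsq : 0 < √ε := Real.sqrt_pos.mpr he
    have := Real.pi_lt_d2
    have e : Real.pi * (3 * s / (2 * √ε)) = (Real.pi * 3 / 2) * s / √ε := by field_simp
    rw [e]
    gcongr
    linarith
  have m6 : 1 - U x0 ^ 3 ≤ 3 * (1 - U x0) := by
    have a1 := h.nonneg x0
    have a2 := h.lt_one' x0
    nlinarith [mul_nonneg (sub_nonneg.mpr a2.le) a1, mul_nonneg (mul_nonneg (sub_nonneg.mpr a2.le) a1) a1,
      mul_nonneg (sub_nonneg.mpr a2.le) (sub_nonneg.mpr a2.le), mul_nonneg (mul_nonneg (sub_nonneg.mpr a2.le) (sub_nonneg.mpr a2.le)) a1]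
  have m7 : c * ε / J' ≤ 3 * (1 - U x0) * Real.exp (5 * s / √ε) :=
    m4.trans (mul_le_mul m6 m5 (Real.exp_pos _).le (by linarith [h.lt_one' x0]))
  rw [Real.exp_neg, ← div_eq_mul_inv, div_le_iff₀ (Real.exp_pos _)]
  calc c / (3 * J') * ε = (c * ε / J') / 3 := by field_simp
    _ ≤ (3 * (1 - U x0) * Real.exp (5 * s / √ε)) / 3 := by gcongr
    _ = _ := by ring

end Sol

/-- exponential barriers -/
lemma lap_barrier (c x : EuclideanSpace ℝ (Fin d)) (A κ b : ℝ) (hb : 0 < ‖x - c‖ ^ 2 + b) :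
    ContDiffAt ℝ 2 (fun z => A * Real.exp (κ * √(‖z - c‖ ^ 2 + b))) x ∧
    laplacian (fun z => A * Real.exp (κ * √(‖z - c‖ ^ 2 + b))) x =
      (κ ^ 2 * ‖x - c‖ ^ 2 / (‖x - c‖ ^ 2 + b) - κ * ‖x - c‖ ^ 2 / √(‖x - c‖ ^ 2 + b) ^ 3
        + d * κ / √(‖x - c‖ ^ 2 + b)) * (A * Real.exp (κ * √(‖x - c‖ ^ 2 + b))) := by
  constructor
  · refine contDiffAt_const.mul (ContDiffAt.exp (contDiffAt_const.mul (ContDiffAt.sqrt ?_ hb.ne')))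
    exact (contDiff_nsq c).contDiffAt.add contDiffAt_const
  have hsq : ∀ q : ℝ, 0 < q + b → HasDerivAt (fun q => √(q + b)) (1 / (2 * √(q + b))) q := by
    intro q hq
    exact ((hasDerivAt_id q).add_const b).sqrt hq.ne'
  have h1 : ∀ᶠ q in 𝓝 (‖x - c‖ ^ 2), HasDerivAt (fun q => A * Real.exp (κ * √(q + b)))
      (A * Real.exp (κ * √(q + b)) * (κ * (1 / (2 * √(q + b))))) q := by
    have : ∀ᶠ q in 𝓝 (‖x - c‖ ^ 2), 0 < q + b :=
      (continuousAt_const).eventually_lt (by fun_prop) hb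
    filter_upwards [this] with q hq
    exact ((((hsq q hq).const_mul κ).exp).const_mul A).congr_deriv (by ring)
  have hr : 0 < √(‖x - c‖ ^ 2 + b) := Real.sqrt_pos.mpr hb
  have h2 : HasDerivAt (fun q => A * Real.exp (κ * √(q + b)) * (κ * (1 / (2 * √(q + b)))))
      (A * Real.exp (κ * √(‖x - c‖ ^ 2 + b)) * (κ * (1 / (2 * √(‖x - c‖ ^ 2 + b)))) *
        (κ * (1 / (2 * √(‖x - c‖ ^ 2 + b)))) + A * Real.exp (κ * √(‖x - c‖ ^ 2 + b)) *
        (κ * (-(1 / √(‖x - c‖ ^ 2 + b)) / (2 * √(‖x - c‖ ^ 2 + b)) ^ 2))) (‖x - c‖ ^ 2) := by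
    have e1 := (((hsq _ hb).const_mul κ).exp).const_mul A
    have e2 : HasDerivAt (fun q => κ * (1 / (2 * √(q + b))))
        (κ * (-(1 / √(‖x - c‖ ^ 2 + b)) / (2 * √(‖x - c‖ ^ 2 + b)) ^ 2)) (‖x - c‖ ^ 2) := by
      have := (((hsq _ hb).const_mul 2).fun_inv (by positivity)).const_mul κ
      simp only [one_div] at this ⊢
      refine this.congr_deriv ?_
      field_simp
    exact (e1.mul e2).congr_deriv (by ring)
  rw [laplacian_radial c x h1 h2]
  have hr2 : ‖x - c‖ ^ 2 + b = √(‖x - c‖ ^ 2 + b) ^ 2 := (Real.sq_sqrt hb.le).symm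
  have hr3 : κ ^ 2 * ‖x - c‖ ^ 2 / (‖x - c‖ ^ 2 + b) =
    κ ^ 2 * ‖x - c‖ ^ 2 / √(‖x - c‖ ^ 2 + b) ^ 2 := by rw [← hr2]
  rw [hr3]
  set r := √(‖x - c‖ ^ 2 + b)
  field_simp
  ring

end pde

section final
variable {d : ℕ}

namespace Sol
variable {O : Set (EuclideanSpace ℝ (Fin d))} {ε : ℝ} {U : EuclideanSpace ℝ (Fin d) → ℝ}

lemma c2' (h : Sol O ε U) {x} (hx : x ∈ O) : ContDiffAt ℝ 2 (fun z => 1 - U z) x :=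
  contDiffAt_const.sub (h.c2 x hx)

lemma lap' (h : Sol O ε U) {x} (hx : x ∈ O) : laplacian (fun z => 1 - U z) x = (1 - U x) / ε := by
  rw [laplacian_sub contDiffAt_const (h.c2 x hx), laplacian_const, h.lap x hx]; ring

lemma upper_bar (h : Sol O ε U) (hO : IsOpen O) (hOb : Bornology.IsBounded O)
    (y : EuclideanSpace ℝ (Fin d)) {s A κ : ℝ} (hs : 0 < s) (hA : 0 ≤ A) (hA1 : A ≤ 1)
    (hball : ∀ x ∈ closedBall y s, A ≤ 1 - U x) (hκ : 0 < κ) (hκ2 : 1 / ε ≤ κ ^ 2 - d * κ / s) :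
    ∀ x ∈ closure O, A * Real.exp (-(κ * ‖x - y‖)) ≤ 1 - U x := by
  have hU := h.cont
  have he := h.eps
  have hle : ∀ x, A * Real.exp (-(κ * ‖x - y‖)) ≤ A := fun x => by
    have : Real.exp (-(κ * ‖x - y‖)) ≤ 1 := Real.exp_le_one_iff.mpr (by
      have := mul_nonneg hκ.le (norm_nonneg (x - y)); linarith)
    nlinarith
  have hform : ∀ x, A * Real.exp ((-κ) * √(‖x - y‖ ^ 2 + 0)) = A * Real.exp (-(κ * ‖x - y‖)) := by
    intro x
    rw [add_zero, Real.sqrt_sq (norm_nonneg _), neg_mul]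
  intro x hx
  by_cases hxb : x ∈ closedBall y s
  · exact (hle x).trans (hball x hxb)
  have hK : IsCompact (closure O \ ball y s) := hOb.isCompact_closure.diff isOpen_ball
  have key := max_principle hK
    (f := fun z => A * Real.exp ((-κ) * √(‖z - y‖ ^ 2 + 0)) - (1 - U z)) (by fun_prop) ?_ x
    ⟨hx, fun h => hxb (ball_subset_closedBall h)⟩
  · simp only [hform] at key
    linarith
  intro z hz hfz
  simp only [hform] at hfz
  have hzb : z ∉ closedBall y s := fun hb => by
    have := hball z hb
    have := hle z
    linarith
  have hzO : z ∈ O := by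
    by_contra hzO
    rw [h.off z hzO] at hfz
    have := hle z
    linarith
  have hr : s < ‖z - y‖ := by simpa [dist_eq_norm] using hzb
  have hr0 : 0 < ‖z - y‖ := hs.trans hr
  obtain ⟨b1, b2⟩ := lap_barrier y z A (-κ) 0 (by positivity)
  refine ⟨?_, b1.sub (h.c2' hzO), ?_⟩
  · filter_upwards [hO.mem_nhds hzO, isClosed_closedBall.isOpen_compl.mem_nhds hzb] with w hw hw2
    exact ⟨subset_closure hw, fun h => hw2 (ball_subset_closedBall h)⟩
  rw [laplacian_sub b1 (h.c2' hzO), b2, h.lap' hzO, hform]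
  simp only [add_zero, Real.sqrt_sq hr0.le]
  set r := ‖z - y‖
  have hφ : 0 ≤ A * Real.exp (-(κ * r)) := by positivity
  have e : (-κ) ^ 2 * r ^ 2 / r ^ 2 - -κ * r ^ 2 / r ^ 3 + d * -κ / r = κ ^ 2 + κ / r - d * κ / r := by
    field_simp
    ring
  have e2 : 1 / ε ≤ (-κ) ^ 2 * r ^ 2 / r ^ 2 - -κ * r ^ 2 / r ^ 3 + d * -κ / r := by
    rw [e]
    have : d * κ / r ≤ d * κ / s := by gcongr
    have : 0 < κ / r := by positivity
    linarith
  have e3 := mul_le_mul_of_nonneg_right e2 hφ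
  have e4 : (1 - U z) / ε < 1 / ε * (A * Real.exp (-(κ * r))) := by
    rw [div_eq_mul_one_div, mul_comm]
    apply mul_lt_mul_of_pos_left _ (by positivity)
    linarith
  linarith

lemma lower_bar (h : Sol O ε U) (hO : IsOpen O) (hOb : Bornology.IsBounded O)
    {a κ : ℝ} (ha : 0 < a) (hκ : 0 < κ) (hκ2 : κ ^ 2 + d * κ / a ≤ 1 / ε) :
    ∀ x ∈ closure O, 1 - U x ≤ Real.exp (κ * (a - infDist x (frontier O))) := by
  have hU := h.cont
  have he := h.eps
  intro x hx
  set R := infDist x (frontier O)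
  have key := max_principle hOb.isCompact_closure
    (f := fun z => (1 - U z) - Real.exp (-(κ * R)) * Real.exp (κ * √(‖z - x‖ ^ 2 + a ^ 2)))
    (by fun_prop) ?_ x hx
  · simp only [sub_self, norm_zero, ne_eq, OfNat.ofNat_ne_zero, not_false_eq_true, zero_pow, zero_add,
      Real.sqrt_sq ha.le, ← Real.exp_add] at key
    have e : κ * (a - R) = -(κ * R) + κ * a := by ring
    rw [e]; linarith
  intro z hz hfz
  have hzO : z ∈ O := by
    by_contra hzO
    have hzf : z ∈ frontier O := by rw [hO.frontier_eq]; exact ⟨hz, hzO⟩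
    rw [h.off z hzO, ← Real.exp_add] at hfz
    have h1 : R ≤ ‖z - x‖ := by
      have := infDist_le_dist_of_mem (x := x) hzf
      rwa [dist_comm, dist_eq_norm] at this
    have h2 : ‖z - x‖ ≤ √(‖z - x‖ ^ 2 + a ^ 2) := Real.le_sqrt_of_sq_le (by nlinarith)
    have h3 : 1 ≤ Real.exp (-(κ * R) + κ * √(‖z - x‖ ^ 2 + a ^ 2)) :=
      Real.one_le_exp (by nlinarith)
    linarith
  have hb : 0 < ‖z - x‖ ^ 2 + a ^ 2 := by positivity
  obtain ⟨b1, b2⟩ := lap_barrier x z (Real.exp (-(κ * R))) κ (a ^ 2) hb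
  refine ⟨mem_of_superset (hO.mem_nhds hzO) subset_closure, (h.c2' hzO).sub b1, ?_⟩
  rw [laplacian_sub (h.c2' hzO) b1, b2, h.lap' hzO]
  set φ := Real.exp (-(κ * R)) * Real.exp (κ * √(‖z - x‖ ^ 2 + a ^ 2))
  have hφ : 0 < φ := by positivity
  have hr : 0 < √(‖z - x‖ ^ 2 + a ^ 2) := Real.sqrt_pos.mpr hb
  have har : a ≤ √(‖z - x‖ ^ 2 + a ^ 2) := Real.le_sqrt_of_sq_le (by nlinarith [sq_nonneg ‖z - x‖])
  have e1 : κ ^ 2 * ‖z - x‖ ^ 2 / (‖z - x‖ ^ 2 + a ^ 2) ≤ κ ^ 2 := by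
    rw [div_le_iff₀ hb]; nlinarith [mul_nonneg (sq_nonneg κ) (sq_nonneg a)]
  have e2 : 0 ≤ κ * ‖z - x‖ ^ 2 / √(‖z - x‖ ^ 2 + a ^ 2) ^ 3 := by positivity
  have e3 : d * κ / √(‖z - x‖ ^ 2 + a ^ 2) ≤ d * κ / a := by gcongr
  have e4 := mul_le_mul_of_nonneg_right (show κ ^ 2 * ‖z - x‖ ^ 2 / (‖z - x‖ ^ 2 + a ^ 2)
    - κ * ‖z - x‖ ^ 2 / √(‖z - x‖ ^ 2 + a ^ 2) ^ 3 + d * κ / √(‖z - x‖ ^ 2 + a ^ 2) ≤ 1 / ε by linarith)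
    hφ.le
  have e5 : 1 / ε * φ < (1 - U z) / ε := by
    rw [div_mul_eq_mul_div, one_mul]
    apply div_lt_div_of_pos_right _ he
    linarith
  linarith

lemma frontier_ne (h : Sol O ε U) (hO : IsOpen O) (hOb : Bornology.IsBounded O) (hne : O.Nonempty) :
    (frontier O).Nonempty := by
  by_contra hf
  rw [not_nonempty_iff_eq_empty, hO.frontier_eq, sdiff_eq_empty] at hf
  obtain ⟨x, hx⟩ := hne
  have hU := h.cont
  have := max_principle hOb.isCompact_closure (f := fun z => 1 - U z) (by fun_prop)
    (fun z hz hp => ⟨mem_of_superset (hO.mem_nhds (hf hz)) subset_closure, h.c2' (hf hz), by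
      rw [h.lap' (hf hz)]; exact div_pos hp h.eps⟩) x (subset_closure hx)
  have := h.lt_one x hx
  linarith

lemma of_indicator (hO : IsOpen O) (hε : 0 < ε) {u : EuclideanSpace ℝ (Fin d) → ℝ}
    (hcont : ContinuousOn u (closure O)) (hC2 : ContDiffOn ℝ 2 u O)
    (hbound : ∀ x ∈ O, 0 < u x ∧ u x < 1) (hbdry : ∀ x ∈ frontier O, u x = 0)
    (heq : ∀ x ∈ O, -ε * laplacian u x + u x - 1 = 0) : Sol O ε (O.indicator u) := by
  have hev : ∀ x ∈ O, O.indicator u =ᶠ[𝓝 x] u := fun x hx => by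
    filter_upwards [hO.mem_nhds hx] with z hz
    exact indicator_of_mem hz u
  refine ⟨hε, continuous_indicator hbdry hcont, fun x hx => ?_, fun x hx => indicator_of_notMem hx u,
    fun x hx => ?_, fun x hx => ?_, fun x hx => ?_⟩
  · exact ((hC2 x hx).contDiffAt (hO.mem_nhds hx)).congr_of_eventuallyEq (hev x hx)
  · rw [indicator_of_mem hx]; exact (hbound x hx).1
  · rw [indicator_of_mem hx]; exact (hbound x hx).2
  · rw [indicator_of_mem hx, laplacian_congr (hev x hx), eq_div_iff hε.ne']
    linarith [heq x hx]

end Sol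

lemma upper_ev {O : Set (EuclideanSpace ℝ (Fin d))} (hO : IsOpen O)
    (hOb : Bornology.IsBounded O) {ε : ℕ → ℝ} (hε0 : Tendsto ε atTop (𝓝 0))
    {U : ℕ → EuclideanSpace ℝ (Fin d) → ℝ} (h : ∀ n, Sol O (ε n) (U n))
    {y : EuclideanSpace ℝ (Fin d)} (hy : y ∈ frontier O) {η : ℝ} (hη : 0 < η) :
    ∀ᶠ n in atTop, ∀ x ∈ closure O, -√(ε n) * Real.log (1 - U n x) ≤ dist x y + η := by
  have hyO : y ∉ O := by rw [hO.frontier_eq] at hy; exact hy.2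
  obtain ⟨D, hD⟩ := hOb.closure.subset_closedBall y
  set D' := max D 0 with hD'
  have hD0 : 0 ≤ D' := le_max_right _ _
  set s := η / 20 with hs
  have hsp : 0 < s := by positivity
  set δ := η / (4 * (D' + 1)) with hδ
  have hδp : 0 < δ := by positivity
  obtain ⟨c, hc, H⟩ := Sol.near_bdry (h 0) hO hy hsp
  have hsq0 : Tendsto (fun n => √(ε n)) atTop (𝓝 0) := by
    simpa [Function.comp_def] using (Real.continuous_sqrt.tendsto 0).comp hε0
  have ev1 : ∀ᶠ n in atTop, ε n < 1 := hε0.eventually_lt_const one_pos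
  have ev2 : ∀ᶠ n in atTop, d * (1 + δ) * √(ε n) / s < δ := by
    have : Tendsto (fun n => d * (1 + δ) * √(ε n) / s) atTop (𝓝 (d * (1 + δ) * 0 / s)) :=
      (hsq0.const_mul _).div_const _
    exact this.eventually_lt_const (by simpa using hδp)
  have ev3 : ∀ᶠ n in atTop, -√(ε n) * Real.log (c * ε n) < η / 4 := by
    have t1 : Tendsto (fun n => Real.log (√(ε n)) * √(ε n)) atTop (𝓝 0) := by
      have := (Real.continuous_mul_log.tendsto 0).comp hsq0
      simpa [Function.comp_def, mul_comm] using this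
    have t2 : Tendsto (fun n => -√(ε n) * Real.log c - 2 * (Real.log (√(ε n)) * √(ε n))) atTop
        (𝓝 (-0 * Real.log c - 2 * 0)) := (hsq0.neg.mul_const _).sub (t1.const_mul 2)
    have t3 := t2.eventually_lt_const (show (-0 * Real.log c - 2 * 0) < η / 4 by simpa using hη)
    filter_upwards [t3] with n hn
    have he := (h n).eps
    rw [Real.log_mul hc.ne' he.ne']
    rw [Real.log_sqrt he.le] at hn
    linarith
  filter_upwards [ev1, ev2, ev3] with n hn1 hn2 hn3 x hx
  have he := (h n).eps
  have hq : 0 < √(ε n) := Real.sqrt_pos.mpr he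
  have hqq : √(ε n) ^ 2 = ε n := Real.sq_sqrt he.le
  set A := c * ε n * Real.exp (-(5 * s / √(ε n))) with hA
  have hAp : 0 < A := by positivity
  have hball := H (ε n) (U n) hn1.le (h n)
  have hA1 : A ≤ 1 := by
    have := hball y (mem_closedBall_self hsp.le)
    rw [(h n).off y hyO] at this
    linarith
  have hb := (h n).upper_bar hO hOb y hsp hAp.le hA1 hball (κ := (1 + δ) / √(ε n)) (by positivity) (by
    have : ((1 + δ) / √(ε n)) ^ 2 - d * ((1 + δ) / √(ε n)) / s =
      ((1 + δ) ^ 2 - d * (1 + δ) * √(ε n) / s) / √(ε n) ^ 2 := by field_simp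
    rw [this, hqq]
    gcongr
    nlinarith) x hx
  have hl := Real.log_le_log (by positivity) hb
  rw [Real.log_mul hAp.ne' (Real.exp_pos _).ne', Real.log_exp, hA,
    Real.log_mul (by positivity) (Real.exp_pos _).ne', Real.log_exp] at hl
  have hl2 := mul_le_mul_of_nonneg_left hl hq.le
  have e : √(ε n) * (Real.log (c * ε n) + -(5 * s / √(ε n)) + -((1 + δ) / √(ε n) * ‖x - y‖)) =
    √(ε n) * Real.log (c * ε n) - 5 * s - (1 + δ) * ‖x - y‖ := by
    field_simp
    ring
  rw [e] at hl2
  have hxD : ‖x - y‖ ≤ D' := by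
    have := hD hx
    rw [mem_closedBall, dist_eq_norm] at this
    exact this.trans (le_max_left _ _)
  have e2 : δ * ‖x - y‖ ≤ η / 4 := by
    calc δ * ‖x - y‖ ≤ δ * (D' + 1) := by gcongr; linarith
      _ = η / 4 := by rw [hδ]; field_simp
  rw [dist_eq_norm]
  have e3 : 5 * s = η / 4 := by rw [hs]; ring
  linarith

lemma lower_ev {O : Set (EuclideanSpace ℝ (Fin d))} (hO : IsOpen O)
    (hOb : Bornology.IsBounded O) {ε : ℕ → ℝ} (hε0 : Tendsto ε atTop (𝓝 0))
    {U : ℕ → EuclideanSpace ℝ (Fin d) → ℝ} (h : ∀ n, Sol O (ε n) (U n))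
    {y : EuclideanSpace ℝ (Fin d)} (hy : y ∈ frontier O) {η : ℝ} (hη : 0 < η) :
    ∀ᶠ n in atTop, ∀ x ∈ closure O,
      infDist x (frontier O) - η ≤ -√(ε n) * Real.log (1 - U n x) := by
  obtain ⟨D, hD⟩ := hOb.closure.subset_closedBall y
  set D' := max D 0 with hD'
  have hD0 : 0 ≤ D' := le_max_right _ _
  set a := η / 2 with ha
  have hap : 0 < a := by positivity
  -- the slope is `1 / (1 + t)`
  set t := η / (2 * (D' + 1)) with ht
  have htp : 0 < t := by positivity
  set c := 1 / (1 + t) with hc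
  have hcp : 0 < c := by positivity
  have hc1 : c < 1 := by rw [hc, div_lt_one (by positivity)]; linarith
  have hct : 1 - c ≤ t := by
    have : 1 - c = t / (1 + t) := by rw [hc]; field_simp; ring
    rw [this]; exact div_le_self htp.le (by linarith)
  have hsq0 : Tendsto (fun n => √(ε n)) atTop (𝓝 0) := by
    simpa [Function.comp_def] using (Real.continuous_sqrt.tendsto 0).comp hε0
  have ev2 : ∀ᶠ n in atTop, d * c * √(ε n) / a < 1 - c ^ 2 := by
    have : Tendsto (fun n => d * c * √(ε n) / a) atTop (𝓝 (d * c * 0 / a)) :=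
      (hsq0.const_mul _).div_const _
    refine this.eventually_lt_const ?_
    simp only [mul_zero, zero_div]
    nlinarith
  filter_upwards [ev2] with n hn2 x hx
  have he := (h n).eps
  have hq : 0 < √(ε n) := Real.sqrt_pos.mpr he
  have hqq : √(ε n) ^ 2 = ε n := Real.sq_sqrt he.le
  have hb := (h n).lower_bar hO hOb hap (κ := c / √(ε n)) (by positivity) (by
    have : (c / √(ε n)) ^ 2 + d * (c / √(ε n)) / a =
      (c ^ 2 + d * c * √(ε n) / a) / √(ε n) ^ 2 := by field_simp
    rw [this, hqq]
    gcongr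
    linarith) x hx
  have hl := Real.log_le_log (by linarith [(h n).lt_one' x]) hb
  rw [Real.log_exp] at hl
  have hl2 := mul_le_mul_of_nonneg_left hl hq.le
  set R := infDist x (frontier O)
  have e : √(ε n) * (c / √(ε n) * (a - R)) = c * (a - R) := by field_simp
  rw [e] at hl2
  have hR0 : 0 ≤ R := infDist_nonneg
  have hRD : R ≤ D' := by
    have h1 := infDist_le_dist_of_mem (x := x) hy
    have h2 := hD hx
    rw [mem_closedBall] at h2
    exact (h1.trans h2).trans (le_max_left _ _)
  have e2 : (1 - c) * R ≤ η / 2 := by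
    calc (1 - c) * R ≤ t * (D' + 1) := mul_le_mul hct (by linarith) hR0 htp.le
      _ = η / 2 := by rw [ht]; field_simp
  have e3 : c * a ≤ a := by nlinarith
  nlinarith

lemma upper_unif {O : Set (EuclideanSpace ℝ (Fin d))} (hO : IsOpen O)
    (hOb : Bornology.IsBounded O) {ε : ℕ → ℝ} (hε0 : Tendsto ε atTop (𝓝 0))
    {U : ℕ → EuclideanSpace ℝ (Fin d) → ℝ} (h : ∀ n, Sol O (ε n) (U n))
    (hf : (frontier O).Nonempty) {η : ℝ} (hη : 0 < η) :
    ∀ᶠ n in atTop, ∀ x ∈ closure O,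
      -√(ε n) * Real.log (1 - U n x) ≤ infDist x (frontier O) + η := by
  have hc : IsCompact (frontier O) :=
    hOb.isCompact_closure.of_isClosed_subset isClosed_frontier frontier_subset_closure
  obtain ⟨t, ht, hcov⟩ := hc.elim_nhds_subcover (fun y => ball y (η / 2))
    (fun y _ => ball_mem_nhds y (by positivity))
  have ev : ∀ᶠ n in atTop, ∀ y ∈ t, ∀ x ∈ closure O,
      -√(ε n) * Real.log (1 - U n x) ≤ dist x y + η / 2 := by
    rw [Filter.eventually_all_finset]
    exact fun y hy => upper_ev hO hOb hε0 h (ht y hy) (by positivity)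
  filter_upwards [ev] with n hn x hx
  obtain ⟨z, hz, hzd⟩ := hc.exists_infDist_eq_dist hf x
  obtain ⟨y, hy, hzy⟩ := mem_iUnion₂.mp (hcov hz)
  have h1 := hn y hy x hx
  have h2 := dist_triangle x z y
  rw [mem_ball] at hzy
  linarith

end final

theorem stmt1 {d : ℕ} (O : Set (EuclideanSpace ℝ (Fin d))) (hO : IsOpen O)
    (hOne : O.Nonempty) (hOb : Bornology.IsBounded O)
    (ε : ℕ → ℝ) (hε : ∀ n, 0 < ε n) (hε0 : Tendsto ε atTop (𝓝 0))
    (u : ℕ → EuclideanSpace ℝ (Fin d) → ℝ)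
    (hcont : ∀ n, ContinuousOn (u n) (closure O))
    (hC2 : ∀ n, ContDiffOn ℝ 2 (u n) O)
    (hbound : ∀ n, ∀ x ∈ O, 0 < u n x ∧ u n x < 1)
    (hbdry : ∀ n, ∀ x ∈ frontier O, u n x = 0)
    (heq : ∀ n, ∀ x ∈ O, -(ε n) * laplacian (u n) x + u n x - 1 = 0) :
    ∀ K ⊆ closure O, IsCompact K →
      TendstoUniformlyOn (fun n x => -Real.sqrt (ε n) * Real.log (1 - u n x))
        (fun x => Metric.infDist x (frontier O)) atTop K := by
  intro K hKO _
  have h : ∀ n, Sol O (ε n) (O.indicator (u n)) := fun n =>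
    Sol.of_indicator hO (hε n) (hcont n) (hC2 n) (hbound n) (hbdry n) (heq n)
  have hU : ∀ n, ∀ x ∈ closure O, O.indicator (u n) x = u n x := by
    intro n x hx
    by_cases hxO : x ∈ O
    · exact indicator_of_mem hxO _
    · rw [indicator_of_notMem hxO, hbdry n x (by rw [hO.frontier_eq]; exact ⟨hx, hxO⟩)]
  have hf := (h 0).frontier_ne hO hOb hOne
  obtain ⟨y, hy⟩ := id hf
  rw [Metric.tendstoUniformlyOn_iff]
  intro e he
  filter_upwards [upper_unif hO hOb hε0 h hf (half_pos he),
    lower_ev hO hOb hε0 h hy (half_pos he)] with n h1 h2 x hx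
  have h3 := h1 x (hKO hx)
  have h4 := h2 x (hKO hx)
  rw [hU n x (hKO hx)] at h3 h4
  rw [Real.dist_eq, abs_lt]
  constructor <;> linarith
end

section
/- Let O ⊆ ℝᵈ be a nonempty bounded open set with boundary ∂O, and let (ε_n) be a sequence of positive real numbers with ε_n → 0. For each n, let u_n : ℝᵈ → ℝ be continuous on the closure of O, twice continuously differentiable on O, satisfy −1 < u_n(x) < 0 for all x ∈ O, u_n(x) = 0 for all x ∈ ∂O, and the equation −ε_n·Δu_n(x) + u_n(x) + 1 = 0 for all x ∈ O. Then the functions w_n(x) = √(ε_n) · log(1 + u_n(x)) converge, as n → ∞, to the negated distance function x ↦ −dist(x, ∂O) uniformly on every compact subset of the closure of O. -/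
open MeasureTheory Filter Topology Metric Set

namespace EikonalAux

abbrev Eu (d : ℕ) := EuclideanSpace ℝ (Fin d)

/-- partial derivative -/
noncomputable def pd {d : ℕ} (f : Eu d → ℝ) (i : Fin d) (x : Eu d) : ℝ :=
  fderiv ℝ f x (EuclideanSpace.single i 1)

lemma lap_eq {d : ℕ} (f : Eu d → ℝ) (x : Eu d) :
    laplacian f x = ∑ i, pd (pd f i) i x := rfl

lemma pd_congr {d : ℕ} {f g : Eu d → ℝ} {x : Eu d} (h : f =ᶠ[𝓝 x] g) (i : Fin d) :
    pd f i =ᶠ[𝓝 x] pd g i := by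
  filter_upwards [h.fderiv (𝕜 := ℝ)] with y hy
  simp [pd, hy]

lemma lap_congr {d : ℕ} {f g : Eu d → ℝ} {x : Eu d} (h : f =ᶠ[𝓝 x] g) :
    laplacian f x = laplacian g x := by
  rw [lap_eq, lap_eq]
  refine Finset.sum_congr rfl fun i _ => ?_
  exact (pd_congr (pd_congr h i) i).self_of_nhds

lemma pd_diff {d : ℕ} {f : Eu d → ℝ} {x : Eu d} (h : ContDiffAt ℝ 2 f x) (i : Fin d) :
    DifferentiableAt ℝ (pd f i) x := by
  have h1 : ContDiffAt ℝ 1 (fderiv ℝ f) x := h.fderiv_right (by norm_num)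
  have h2 : DifferentiableAt ℝ (fderiv ℝ f) x := h1.differentiableAt (by norm_num)
  exact h2.clm_apply (differentiableAt_const _)

lemma ev_diff {d : ℕ} {f : Eu d → ℝ} {x : Eu d} (h : ContDiffAt ℝ 2 f x) :
    ∀ᶠ y in 𝓝 x, DifferentiableAt ℝ f y := by
  have := h.eventually (by simp)
  filter_upwards [this] with y hy
  exact hy.differentiableAt (by norm_num)

lemma lap_sub {d : ℕ} {f g : Eu d → ℝ} {x : Eu d} (hf : ContDiffAt ℝ 2 f x)
    (hg : ContDiffAt ℝ 2 g x) :
    laplacian (fun y => f y - g y) x = laplacian f x - laplacian g x := by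
  rw [lap_eq, lap_eq, lap_eq, ← Finset.sum_sub_distrib]
  refine Finset.sum_congr rfl fun i _ => ?_
  have : pd (fun y => f y - g y) i =ᶠ[𝓝 x] fun y => pd f i y - pd g i y := by
    filter_upwards [ev_diff hf, ev_diff hg] with y h1 h2
    simp [pd, fderiv_fun_sub h1 h2]
  rw [(pd_congr this i).self_of_nhds]
  have h1 := pd_diff hf i
  have h2 := pd_diff hg i
  have h3 : fderiv ℝ (fun y => pd f i y - pd g i y) x = _ := fderiv_fun_sub h1 h2
  rw [pd, h3]
  rfl

lemma lap_const_mul {d : ℕ} {f : Eu d → ℝ} {x : Eu d} (hf : ContDiffAt ℝ 2 f x) (c : ℝ) :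
    laplacian (fun y => c * f y) x = c * laplacian f x := by
  rw [lap_eq, lap_eq, Finset.mul_sum]
  refine Finset.sum_congr rfl fun i _ => ?_
  have : pd (fun y => c * f y) i =ᶠ[𝓝 x] fun y => c * pd f i y := by
    filter_upwards [ev_diff hf] with y h1
    simp [pd, fderiv_const_mul h1]
  rw [(pd_congr this i).self_of_nhds]
  have h1 := pd_diff hf i
  have h3 : fderiv ℝ (fun y => c * pd f i y) x = _ := fderiv_const_mul h1 c
  rw [pd, h3]
  rfl

lemma pd_comp {d : ℕ} {f : Eu d → ℝ} {x : Eu d} {F : ℝ → ℝ} {a : ℝ}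
    (hf : DifferentiableAt ℝ f x) (hF : HasDerivAt F a (f x)) (i : Fin d) :
    pd (fun y => F (f y)) i x = a * pd f i x := by
  have := hF.comp_hasFDerivAt x hf.hasFDerivAt
  simp only [pd]
  have h2 : fderiv ℝ (fun y => F (f y)) x = a • fderiv ℝ f x := this.fderiv
  rw [h2]; simp

lemma lap_comp {d : ℕ} {f : Eu d → ℝ} {x : Eu d} {F F' : ℝ → ℝ} {F2 : ℝ}
    (hf : ContDiffAt ℝ 2 f x) (hF : ∀ᶠ t in 𝓝 (f x), HasDerivAt F (F' t) t)
    (hF' : HasDerivAt F' F2 (f x)) :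
    laplacian (fun y => F (f y)) x = F' (f x) * laplacian f x + F2 * ∑ i, (pd f i x) ^ 2 := by
  rw [lap_eq, lap_eq, Finset.mul_sum, Finset.mul_sum, ← Finset.sum_add_distrib]
  refine Finset.sum_congr rfl fun i _ => ?_
  have hc : ContinuousAt f x := hf.continuousAt
  have : pd (fun y => F (f y)) i =ᶠ[𝓝 x] fun y => F' (f y) * pd f i y := by
    filter_upwards [ev_diff hf, hc.eventually hF] with y h1 h2
    exact pd_comp h1 h2 i
  rw [(pd_congr this i).self_of_nhds]
  have h1 := (pd_diff hf i).hasFDerivAt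
  have h2 := hF'.comp_hasFDerivAt x (hf.differentiableAt (by norm_num)).hasFDerivAt
  have h3 := h2.mul h1
  have h4 : fderiv ℝ (fun y => F' (f y) * pd f i y) x = _ := h3.fderiv
  rw [pd, h4]
  simp only [pd, Function.comp]
  simp
  ring

lemma lap_nonpos_of_isLocalMax {d : ℕ} {f : Eu d → ℝ} {x : Eu d} (hf : ContDiffAt ℝ 2 f x)
    (hm : IsLocalMax f x) : laplacian f x ≤ 0 := by
  rw [lap_eq]
  refine Finset.sum_nonpos fun i _ => ?_
  by_contra hcon
  push Not at hcon
  set e : Eu d := EuclideanSpace.single i 1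
  set φ : ℝ → ℝ := fun t => f (x + t • e) with hφ
  have hl : ∀ t : ℝ, HasDerivAt (fun t : ℝ => x + t • e) e t := fun t => by
    simpa using ((hasDerivAt_id t).smul_const e).const_add x
  have hc : ContinuousAt (fun t : ℝ => x + t • e) 0 := (hl 0).continuousAt
  have hx0 : x + (0 : ℝ) • e = x := by simp
  have hd : deriv φ =ᶠ[𝓝 0] fun t => pd f i (x + t • e) := by
    have h1 := ev_diff hf
    rw [← hx0] at h1
    filter_upwards [hc.eventually h1] with t ht
    exact (ht.hasFDerivAt.comp_hasDerivAt t (hl t)).deriv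
  have h2 : deriv (deriv φ) 0 = pd (pd f i) i x := by
    rw [hd.deriv_eq]
    have h1 := (pd_diff hf i).hasFDerivAt
    rw [← hx0] at h1
    have := (h1.comp_hasDerivAt (0 : ℝ) (hl 0)).deriv
    rw [hx0] at this
    exact this
  have hmax : IsLocalMax φ 0 := by
    have h1 : ∀ᶠ y in 𝓝 (x + (0 : ℝ) • e), f y ≤ f x := by rw [hx0]; exact hm
    have := hc.eventually h1
    filter_upwards [this] with t ht
    simpa [hφ] using ht
  have hcφ : ContinuousAt φ 0 := by
    have h1 : ContinuousAt f (x + (0 : ℝ) • e) := by rw [hx0]; exact hf.continuousAt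
    exact ContinuousAt.comp (f := fun t : ℝ => x + t • e) h1 hc
  have hmin : IsLocalMin φ 0 := isLocalMin_of_deriv_deriv_pos (by rw [h2]; exact hcon)
    hmax.deriv_eq_zero hcφ
  have hconst : φ =ᶠ[𝓝 0] fun _ => φ 0 := by
    filter_upwards [hmax, hmin] with t h1 h2
    exact le_antisymm h1 h2
  have : deriv φ =ᶠ[𝓝 0] fun _ => 0 := by
    have := hconst.deriv
    simpa using this
  rw [this.deriv_eq] at h2
  simp at h2
  rw [← h2] at hcon
  exact lt_irrefl _ hcon

lemma contDiff_sq {d : ℕ} (x0 : Eu d) : ContDiff ℝ 2 (fun x : Eu d => ‖x - x0‖ ^ 2) :=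
  (contDiff_id.sub contDiff_const).norm_sq ℝ

lemma pd_sq {d : ℕ} (x0 x : Eu d) (i : Fin d) :
    pd (fun x : Eu d => ‖x - x0‖ ^ 2) i x = 2 * (x i - x0 i) := by
  have h : HasFDerivAt (fun x : Eu d => ‖x - x0‖ ^ 2) _ x :=
    ((hasFDerivAt_id x).sub_const x0).norm_sq
  rw [pd, h.fderiv]
  simp [EuclideanSpace.inner_single_right]

lemma lap_sq {d : ℕ} (x0 x : Eu d) :
    laplacian (fun x : Eu d => ‖x - x0‖ ^ 2) x = 2 * d := by
  rw [lap_eq]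
  have : ∀ i, pd (pd (fun x : Eu d => ‖x - x0‖ ^ 2) i) i x = 2 := by
    intro i
    have h : pd (fun x : Eu d => ‖x - x0‖ ^ 2) i = fun x => 2 * (x i - x0 i) := by
      funext y; exact pd_sq x0 y i
    rw [h, pd]
    have h1 : HasFDerivAt (fun x : Eu d => x i) (EuclideanSpace.proj i : Eu d →L[ℝ] ℝ) x :=
      (EuclideanSpace.proj i : Eu d →L[ℝ] ℝ).hasFDerivAt
    have h2 := (h1.sub_const (x0 i)).const_mul 2
    rw [h2.fderiv]
    simp
  rw [Finset.sum_congr rfl (fun i _ => this i)]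
  simp [mul_comm]

lemma lap_radial {d : ℕ} (x0 x : Eu d) {F F' : ℝ → ℝ} {F2 : ℝ}
    (hF : ∀ᶠ t in 𝓝 (‖x - x0‖ ^ 2), HasDerivAt F (F' t) t)
    (hF' : HasDerivAt F' F2 (‖x - x0‖ ^ 2)) :
    laplacian (fun y => F (‖y - x0‖ ^ 2)) x =
      2 * d * F' (‖x - x0‖ ^ 2) + 4 * ‖x - x0‖ ^ 2 * F2 := by
  rw [lap_comp (f := fun x : Eu d => ‖x - x0‖ ^ 2) (contDiff_sq x0).contDiffAt hF hF', lap_sq]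
  have : ∑ i, (pd (fun x : Eu d => ‖x - x0‖ ^ 2) i x) ^ 2 = 4 * ‖x - x0‖ ^ 2 := by
    rw [EuclideanSpace.norm_sq_eq, Finset.mul_sum]
    refine Finset.sum_congr rfl fun i _ => ?_
    rw [pd_sq]
    simp [mul_pow]
    norm_num
  rw [this]; ring

lemma cont_pd {d : ℕ} {f : Eu d → ℝ} (hf : ContDiff ℝ 1 f) (i : Fin d) :
    Continuous (pd f i) :=
  (hf.continuous_fderiv (by norm_num)).clm_apply continuous_const

lemma contDiff_pd {d : ℕ} {f : Eu d → ℝ} (hf : ContDiff ℝ 2 f) (i : Fin d) :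
    ContDiff ℝ 1 (pd f i) :=
  (hf.fderiv_right (by norm_num)).clm_apply contDiff_const

lemma cont_lap {d : ℕ} {f : Eu d → ℝ} (hf : ContDiff ℝ 2 f) : Continuous (laplacian f) := by
  have : laplacian f = fun x => ∑ i, pd (pd f i) i x := rfl
  rw [this]
  exact continuous_finsetSum _ fun i _ => cont_pd (contDiff_pd hf i) i

lemma hcs_pd {d : ℕ} {f : Eu d → ℝ} (hf : HasCompactSupport f) (i : Fin d) :
    HasCompactSupport (pd f i) := hf.fderiv_apply ℝ _

lemma green {d : ℕ} {f g : Eu d → ℝ} (hf : ContDiff ℝ 2 f) (hs : HasCompactSupport f)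
    (hg : ContDiff ℝ 2 g) :
    ∫ x, f x * laplacian g x = ∫ x, laplacian f x * g x := by
  have hf1 : ContDiff ℝ 1 f := hf.of_le (by norm_num)
  have hg1 : ContDiff ℝ 1 g := hg.of_le (by norm_num)
  have I1 : ∀ i, Integrable (fun x => f x * pd (pd g i) i x) := fun i =>
    (hf.continuous.mul (cont_pd (contDiff_pd hg i) i)).integrable_of_hasCompactSupport hs.mul_right
  have I2 : ∀ i, Integrable (fun x => pd (pd f i) i x * g x) := fun i =>
    ((cont_pd (contDiff_pd hf i) i).mul hg.continuous).integrable_of_hasCompactSupport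
      (hcs_pd (hcs_pd hs i) i).mul_right
  have I3 : ∀ i, Integrable (fun x => pd f i x * pd g i x) := fun i =>
    ((cont_pd hf1 i).mul (cont_pd hg1 i)).integrable_of_hasCompactSupport
      (hcs_pd hs i).mul_right
  have I4 : ∀ i, Integrable (fun x => f x * pd g i x) := fun i =>
    (hf.continuous.mul (cont_pd hg1 i)).integrable_of_hasCompactSupport hs.mul_right
  have I5 : ∀ i, Integrable (fun x => pd f i x * g x) := fun i =>
    ((cont_pd hf1 i).mul hg.continuous).integrable_of_hasCompactSupport
      (hcs_pd hs i).mul_right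
  simp only [lap_eq, Finset.mul_sum, Finset.sum_mul]
  rw [integral_finsetSum _ (fun i _ => I1 i), integral_finsetSum _ (fun i _ => I2 i)]
  refine Finset.sum_congr rfl fun i _ => ?_
  have e1 : ∫ x, f x * pd (pd g i) i x = - ∫ x, pd f i x * pd g i x :=
    integral_mul_fderiv_eq_neg_fderiv_mul_of_integrable (I3 i) (I1 i) (I4 i)
      (fun x _ => hf.differentiable (by norm_num) x)
      (fun x _ => (contDiff_pd hg i).differentiable (by norm_num) x)
  have e2 : ∫ x, pd f i x * pd g i x = - ∫ x, pd (pd f i) i x * g x :=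
    integral_mul_fderiv_eq_neg_fderiv_mul_of_integrable (I2 i) (I3 i) (I5 i)
      (fun x _ => (contDiff_pd hf i).differentiable (by norm_num) x)
      (fun x _ => hg.differentiable (by norm_num) x)
  rw [e1, e2, neg_neg]


/-- smooth convex truncation -/
noncomputable def tr' (η t : ℝ) : ℝ := Real.smoothTransition (t / η - 1)

/-- smooth convex truncation -/
noncomputable def tr (η t : ℝ) : ℝ := ∫ s in (0 : ℝ)..t, tr' η s

lemma tr'_contDiff (η : ℝ) : ContDiff ℝ 1 (tr' η) := by
  have : ContDiff ℝ 1 Real.smoothTransition := Real.smoothTransition.contDiff (n := 1)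
  exact this.comp ((contDiff_id.div_const η).sub contDiff_const)

lemma tr_hasDerivAt (η t : ℝ) : HasDerivAt (tr η) (tr' η t) t := by
  have hc := (tr'_contDiff η).continuous
  exact intervalIntegral.integral_hasDerivAt_right (hc.intervalIntegrable _ _)
    (hc.stronglyMeasurableAtFilter _ _) hc.continuousAt

lemma tr_contDiff (η : ℝ) : ContDiff ℝ 2 (tr η) := by
  have h : deriv (tr η) = tr' η := funext fun t => (tr_hasDerivAt η t).deriv
  have : ContDiff ℝ (1 + 1) (tr η) := by
    rw [contDiff_succ_iff_deriv]
    refine ⟨fun t => (tr_hasDerivAt η t).differentiableAt, by simp, ?_⟩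
    rw [h]; exact tr'_contDiff η
  simpa [one_add_one_eq_two] using this

lemma tr'_mono {η : ℝ} (hη : 0 < η) : Monotone (tr' η) := by
  intro a b hab
  apply Real.smoothTransition.monotone
  gcongr

lemma tr'_zero {η t : ℝ} (hη : 0 < η) (ht : t ≤ η) : tr' η t = 0 := by
  apply Real.smoothTransition.zero_of_nonpos
  have : t / η ≤ 1 := (div_le_one hη).2 ht
  linarith

lemma tr'_one {η t : ℝ} (hη : 0 < η) (ht : 2 * η ≤ t) : tr' η t = 1 := by
  apply Real.smoothTransition.one_of_one_le
  have : 2 ≤ t / η := (le_div_iff₀ hη).2 ht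
  linarith

lemma tr_zero {η t : ℝ} (hη : 0 < η) (ht : t ≤ η) : tr η t = 0 := by
  rw [tr, intervalIntegral.integral_congr (g := fun _ => 0)]
  · simp
  · intro s hs
    apply tr'_zero hη
    rcases le_total 0 t with h | h
    · rw [uIcc_of_le h] at hs; exact hs.2.trans ht
    · rw [uIcc_of_ge h] at hs; exact hs.2.trans hη.le

lemma tr_nonneg {η t : ℝ} (ht : 0 ≤ t) : 0 ≤ tr η t :=
  intervalIntegral.integral_nonneg ht fun _ _ => Real.smoothTransition.nonneg _

lemma tr_le {η t : ℝ} (ht : 0 ≤ t) : tr η t ≤ t := by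
  have hc := (tr'_contDiff η).continuous
  have := intervalIntegral.integral_mono_on ht (hc.intervalIntegrable (μ := volume) 0 t)
    (continuous_const.intervalIntegrable (μ := volume) 0 t (u := fun _ => (1 : ℝ)))
    (fun x _ => Real.smoothTransition.le_one _)
  simpa [tr] using this

lemma le_tr {η t : ℝ} (hη : 0 < η) (ht : 0 ≤ t) : t - 2 * η ≤ tr η t := by
  rcases le_total t (2 * η) with h | h
  · linarith [tr_nonneg (η := η) ht]
  · have hc := (tr'_contDiff η).continuous
    have h1 : tr η t = tr η (2 * η) + ∫ s in (2 * η)..t, tr' η s :=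
      (intervalIntegral.integral_add_adjacent_intervals (hc.intervalIntegrable _ _)
        (hc.intervalIntegrable _ _)).symm
    have h2 : ∫ s in (2 * η)..t, tr' η s = t - 2 * η := by
      rw [intervalIntegral.integral_congr (g := fun _ => (1 : ℝ))]
      · simp
      · intro s hs
        rw [uIcc_of_le h] at hs
        exact tr'_one hη hs.1
    linarith [tr_nonneg (η := η) (t := 2 * η) (by positivity)]

lemma hcs_of_zero {d : ℕ} {O : Set (Eu d)} (hOb : Bornology.IsBounded O) {f : Eu d → ℝ}
    (h0 : ∀ x ∉ O, f x = 0) : HasCompactSupport f := by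
  apply HasCompactSupport.of_support_subset_isCompact hOb.isCompact_closure
  intro x hx
  by_contra hcon
  exact hx (h0 x fun h => hcon (subset_closure h))

lemma indicator_integrable {d : ℕ} {O : Set (Eu d)} (hO : IsOpen O)
    (hOb : Bornology.IsBounded O) {f : Eu d → ℝ} (hf : Continuous f) :
    Integrable (O.indicator f) := by
  rw [integrable_indicator_iff hO.measurableSet]
  exact (hf.continuousOn.integrableOn_compact hOb.isCompact_closure).mono_set subset_closure

lemma lap_zero {d : ℕ} (x : Eu d) : laplacian (fun _ : Eu d => (0 : ℝ)) x = 0 := by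
  simp [laplacian]

lemma kato {d : ℕ} {O : Set (Eu d)} (hO : IsOpen O) (hOb : Bornology.IsBounded O)
    {q g χ : Eu d → ℝ} (hq : Continuous q) (hq2 : ContDiffOn ℝ 2 q O)
    (hpos : ∀ x ∈ O, 0 < q x) (h0 : ∀ x ∉ O, q x = 0) (hg : Continuous g)
    (hlap : ∀ x ∈ O, laplacian q x = g x) (hχ : ContDiff ℝ 2 χ) (hχ0 : ∀ x, 0 ≤ χ x) :
    ∫ x, O.indicator (fun x => g x * χ x) x ≤ ∫ x, q x * laplacian χ x := by
  have hq0 : ∀ x, 0 ≤ q x := fun x => by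
    by_cases hx : x ∈ O
    · exact (hpos x hx).le
    · exact (h0 x hx).ge
  set η : ℕ → ℝ := fun k => 1 / ((k : ℝ) + 1) with hηdef
  have hη : ∀ k, 0 < η k := fun k => by positivity
  have hηt : Tendsto η atTop (𝓝 0) := tendsto_one_div_add_atTop_nhds_zero_nat
  have hlapc := cont_lap hχ
  -- local vanishing
  have hloc : ∀ k, ∀ x ∉ O, (fun y => tr (η k) (q y)) =ᶠ[𝓝 x] fun _ => 0 := by
    intro k x hx
    have : ∀ᶠ y in 𝓝 x, q y < η k := hq.continuousAt.eventually_lt continuousAt_const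
      (by rw [h0 x hx]; exact hη k)
    filter_upwards [this] with y hy
    exact tr_zero (hη k) hy.le
  have hC2 : ∀ k, ContDiff ℝ 2 (fun y => tr (η k) (q y)) := by
    intro k
    rw [contDiff_iff_contDiffAt]
    intro x
    by_cases hx : x ∈ O
    · exact (tr_contDiff (η k)).contDiffAt.comp x (hq2.contDiffAt (hO.mem_nhds hx))
    · exact contDiffAt_const.congr_of_eventuallyEq (hloc k x hx)
  have hcs : ∀ k, HasCompactSupport (fun y => tr (η k) (q y)) := fun k =>
    hcs_of_zero hOb fun x hx => (hloc k x hx).self_of_nhds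
  have hstep : ∀ k, ∫ x, O.indicator (fun x => tr' (η k) (q x) * (g x * χ x)) x ≤
      ∫ x, tr (η k) (q x) * laplacian χ x := by
    intro k
    rw [green (hC2 k) (hcs k) hχ]
    apply integral_mono
    · exact indicator_integrable hO hOb
        (((tr'_contDiff (η k)).continuous.comp hq).mul (hg.mul hχ.continuous))
    · exact ((cont_lap (hC2 k)).mul hχ.continuous).integrable_of_hasCompactSupport
        (HasCompactSupport.mul_right (by
          apply hcs_of_zero hOb
          intro x hx
          rw [lap_congr (hloc k x hx), lap_zero]))
    · intro x
      by_cases hx : x ∈ O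
      · simp only [indicator_of_mem hx]
        have hd : DifferentiableAt ℝ (tr' (η k)) (q x) :=
          (tr'_contDiff (η k)).differentiable (by norm_num) _
        rw [lap_comp (hq2.contDiffAt (hO.mem_nhds hx))
          (Eventually.of_forall fun t => tr_hasDerivAt (η k) t) hd.hasDerivAt, hlap x hx]
        have h1 : 0 ≤ deriv (tr' (η k)) (q x) := (tr'_mono (hη k)).deriv_nonneg
        have h2 : 0 ≤ ∑ i, pd q i x ^ 2 := Finset.sum_nonneg fun i _ => sq_nonneg _
        have := mul_nonneg (mul_nonneg h1 h2) (hχ0 x)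
        nlinarith
      · simp only [indicator_of_notMem hx]
        rw [lap_congr (hloc k x hx), lap_zero]
        simp
  have hL : Tendsto (fun k => ∫ x, O.indicator (fun x => tr' (η k) (q x) * (g x * χ x)) x) atTop
      (𝓝 (∫ x, O.indicator (fun x => g x * χ x) x)) := by
    apply tendsto_integral_of_dominated_convergence (O.indicator fun x => |g x * χ x|)
    · intro k
      exact (indicator_integrable hO hOb (((tr'_contDiff (η k)).continuous.comp hq).mul
        (hg.mul hχ.continuous))).aestronglyMeasurable
    · exact indicator_integrable hO hOb (hg.mul hχ.continuous).abs
    · intro k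
      refine Eventually.of_forall fun x => ?_
      by_cases hx : x ∈ O
      · simp only [indicator_of_mem hx, Real.norm_eq_abs]
        have hnn : 0 ≤ tr' (η k) (q x) := Real.smoothTransition.nonneg _
        rw [abs_mul, abs_of_nonneg hnn]
        exact mul_le_of_le_one_left (abs_nonneg _) (Real.smoothTransition.le_one _)
      · simp [indicator_of_notMem hx]
    · refine Eventually.of_forall fun x => ?_
      by_cases hx : x ∈ O
      · simp only [indicator_of_mem hx]
        apply tendsto_const_nhds.congr'
        have : ∀ᶠ k in atTop, η k < q x / 2 := hηt.eventually_lt_const (by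
          have := hpos x hx; positivity)
        filter_upwards [this] with k hk
        rw [tr'_one (hη k) (by linarith), one_mul]
      · simp [indicator_of_notMem hx]
  have hR : Tendsto (fun k => ∫ x, tr (η k) (q x) * laplacian χ x) atTop
      (𝓝 (∫ x, q x * laplacian χ x)) := by
    apply tendsto_integral_of_dominated_convergence (fun x => q x * |laplacian χ x|)
    · intro k
      exact ((hC2 k).continuous.mul hlapc).aestronglyMeasurable
    · exact (hq.mul hlapc.abs).integrable_of_hasCompactSupport (hcs_of_zero hOb h0).mul_right
    · intro k
      refine Eventually.of_forall fun x => ?_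
      rw [Real.norm_eq_abs, abs_mul, abs_of_nonneg (tr_nonneg (hq0 x))]
      exact mul_le_mul_of_nonneg_right (tr_le (hq0 x)) (abs_nonneg _)
    · refine Eventually.of_forall fun x => ?_
      apply Tendsto.mul_const
      have h1 : Tendsto (fun k => q x - 2 * η k) atTop (𝓝 (q x)) := by
        simpa using (hηt.const_mul 2).const_sub (q x)
      exact tendsto_of_tendsto_of_tendsto_of_le_of_le h1 tendsto_const_nhds
        (fun k => le_tr (hη k) (hq0 x)) (fun k => tr_le (hq0 x))
  exact le_of_tendsto_of_tendsto' hL hR hstep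


/-- heat kernel -/
noncomputable def hk {d : ℕ} (x0 : Eu d) (t : ℝ) (x : Eu d) : ℝ :=
  (4 * Real.pi * t) ^ (-((d : ℝ) / 2)) * Real.exp (-(‖x - x0‖ ^ 2) / (4 * t))

lemma hk_pos {d : ℕ} (x0 : Eu d) {t : ℝ} (ht : 0 < t) (x : Eu d) : 0 < hk x0 t x := by
  have := Real.pi_pos
  unfold hk; positivity

lemma hk_contDiff {d : ℕ} (x0 : Eu d) (t : ℝ) : ContDiff ℝ 2 (hk x0 t) := by
  unfold hk
  exact contDiff_const.mul (((contDiff_sq x0).neg.div_const _).exp)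

lemma hk_lap {d : ℕ} (x0 : Eu d) {t : ℝ} (ht : 0 < t) (x : Eu d) :
    laplacian (hk x0 t) x = hk x0 t x * (‖x - x0‖ ^ 2 / (4 * t ^ 2) - d / (2 * t)) := by
  set C := (4 * Real.pi * t) ^ (-((d : ℝ) / 2)) with hC
  have h1 : ∀ s : ℝ, HasDerivAt (fun s => C * Real.exp (-s / (4 * t)))
      (C * (Real.exp (-s / (4 * t)) * (-1 / (4 * t)))) s := fun s =>
    (((hasDerivAt_id s).neg.div_const (4 * t)).exp).const_mul C
  have h2 : ∀ s : ℝ, HasDerivAt (fun s => C * (Real.exp (-s / (4 * t)) * (-1 / (4 * t))))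
      (C * ((Real.exp (-s / (4 * t)) * (-1 / (4 * t))) * (-1 / (4 * t)))) s := fun s =>
    ((((hasDerivAt_id s).neg.div_const (4 * t)).exp).mul_const (-1 / (4 * t))).const_mul C
  have := lap_radial x0 x (Eventually.of_forall h1) (h2 _)
  have e : hk x0 t = fun y => C * Real.exp (-(‖y - x0‖ ^ 2) / (4 * t)) := rfl
  rw [e, this]
  field_simp
  ring

lemma hk_deriv {d : ℕ} (x0 : Eu d) {t : ℝ} (ht : 0 < t) (x : Eu d) :
    HasDerivAt (fun t => hk x0 t x) (laplacian (hk x0 t) x) t := by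
  rw [hk_lap x0 ht]
  have hπ := Real.pi_pos
  have h1 : HasDerivAt (fun t : ℝ => (4 * Real.pi * t) ^ (-((d : ℝ) / 2)))
      ((4 * Real.pi * 1) * (-((d : ℝ) / 2)) * (4 * Real.pi * t) ^ (-((d : ℝ) / 2) - 1)) t :=
    ((hasDerivAt_id t).const_mul (4 * Real.pi)).rpow_const (Or.inl (by simp; positivity))
  have h2 : HasDerivAt (fun t : ℝ => Real.exp (-(‖x - x0‖ ^ 2) / (4 * t)))
      (Real.exp (-(‖x - x0‖ ^ 2) / (4 * t)) * (‖x - x0‖ ^ 2 / (4 * t ^ 2))) t := by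
    apply HasDerivAt.exp
    have h3 : HasDerivAt (fun t : ℝ => 4 * t) 4 t := by simpa using (hasDerivAt_id t).const_mul 4
    refine ((hasDerivAt_const t (-(‖x - x0‖ ^ 2))).div h3 (by positivity)).congr_deriv ?_
    field_simp
    ring
  refine (h1.mul h2).congr_deriv ?_
  rw [Real.rpow_sub_one (by positivity)]
  unfold hk
  field_simp
  ring

lemma hk_integral {d : ℕ} (x0 : Eu d) {t : ℝ} (ht : 0 < t) : ∫ x, hk x0 t x = 1 := by
  have hπ := Real.pi_pos
  unfold hk
  rw [integral_const_mul,
    integral_sub_right_eq_self (fun x : Eu d => Real.exp (-(‖x‖ ^ 2) / (4 * t))) x0]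
  have h := GaussianFourier.integral_rexp_neg_mul_sq_norm (V := Eu d) (b := 1 / (4 * t))
    (by positivity)
  have e : (fun x : Eu d => Real.exp (-(‖x‖ ^ 2) / (4 * t))) =
      fun x => Real.exp (-(1 / (4 * t)) * ‖x‖ ^ 2) := by
    funext x; congr 1; ring
  rw [e, h]
  simp only [finrank_euclideanSpace, Fintype.card_fin]
  have : Real.pi / (1 / (4 * t)) = 4 * Real.pi * t := by field_simp
  rw [this, ← Real.rpow_add (by positivity)]
  simp

lemma hk_integrable {d : ℕ} (x0 : Eu d) {t : ℝ} (ht : 0 < t) : Integrable (hk x0 t) := by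
  by_contra h
  have := hk_integral x0 ht
  rw [integral_undef h] at this
  norm_num at this

lemma hk_contOn {d : ℕ} (x0 : Eu d) :
    ContinuousOn (fun p : ℝ × Eu d => laplacian (hk x0 p.1) p.2) (Ioi 0 ×ˢ univ) := by
  have : ContinuousOn (fun p : ℝ × Eu d => hk x0 p.1 p.2 *
      (‖p.2 - x0‖ ^ 2 / (4 * p.1 ^ 2) - d / (2 * p.1))) (Ioi 0 ×ˢ univ) := by
    have hπ := Real.pi_pos
    have hp : ∀ p ∈ (Ioi 0 ×ˢ univ : Set (ℝ × Eu d)), 0 < p.1 := fun p hp => hp.1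
    unfold hk
    apply ContinuousOn.mul
    · apply ContinuousOn.mul
      · apply ContinuousOn.rpow_const (by fun_prop)
        intro p h; left; have := hp p h; positivity
      · apply ContinuousOn.rexp
        apply ContinuousOn.div (by fun_prop) (by fun_prop)
        intro p h; have := hp p h; positivity
    · apply ContinuousOn.sub
      · apply ContinuousOn.div (by fun_prop) (by fun_prop)
        intro p h; have := hp p h; positivity
      · apply ContinuousOn.div (by fun_prop) (by fun_prop)
        intro p h; have := hp p h; positivity
  refine this.congr fun p hp => hk_lap x0 hp.1 p.2

lemma B_deriv {d : ℕ} {U : Eu d → ℝ} (hU : Continuous U) (hs : HasCompactSupport U) (x0 : Eu d)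
    {t : ℝ} (ht : 0 < t) :
    HasDerivAt (fun t => ∫ x, U x * hk x0 t x) (∫ x, U x * laplacian (hk x0 t) x) t := by
  have hK : IsCompact (Icc (t / 2) (2 * t) ×ˢ tsupport U) := isCompact_Icc.prod hs
  have hsub : (Icc (t / 2) (2 * t) ×ˢ tsupport U) ⊆ (Ioi 0 ×ˢ univ : Set (ℝ × Eu d)) := by
    rintro ⟨a, b⟩ ⟨h1, h2⟩
    exact ⟨lt_of_lt_of_le (by positivity) h1.1, trivial⟩
  obtain ⟨M, hM⟩ := hK.exists_bound_of_continuousOn ((hk_contOn x0).mono hsub)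
  refine (hasDerivAt_integral_of_dominated_loc_of_deriv_le (μ := volume)
    (F := fun t x => U x * hk x0 t x) (F' := fun t x => U x * laplacian (hk x0 t) x)
    (s := Icc (t / 2) (2 * t)) (bound := fun x => |U x| * M)
    (Icc_mem_nhds (by linarith) (by linarith)) ?_ ?_ ?_ ?_ ?_ ?_).2
  · exact Eventually.of_forall fun s =>
      (hU.mul (hk_contDiff x0 s).continuous).aestronglyMeasurable
  · exact (hU.mul (hk_contDiff x0 t).continuous).integrable_of_hasCompactSupport hs.mul_right
  · exact (hU.mul (cont_lap (hk_contDiff x0 t))).aestronglyMeasurable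
  · refine Eventually.of_forall fun x s hsx => ?_
    rw [norm_mul, Real.norm_eq_abs]
    by_cases hx : x ∈ tsupport U
    · exact mul_le_mul_of_nonneg_left (hM (s, x) ⟨hsx, hx⟩) (abs_nonneg _)
    · simp [image_eq_zero_of_notMem_tsupport hx]
  · exact (hU.abs.integrable_of_hasCompactSupport hs.abs).mul_const M
  · refine Eventually.of_forall fun x s hsx => ?_
    exact (hk_deriv x0 (lt_of_lt_of_le (by positivity) hsx.1) x).const_mul _

lemma B_tendsto {d : ℕ} {U : Eu d → ℝ} (hU : Continuous U) (hs : HasCompactSupport U)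
    (x0 : Eu d) :
    Tendsto (fun t => ∫ x, U x * hk x0 t x) (𝓝[>] 0) (𝓝 (U x0)) := by
  have hπ := Real.pi_pos
  have hdecay : Tendsto (fun x : Eu d => ‖x‖ ^ Module.finrank ℝ (Eu d) * hk 0 1 x)
      (Bornology.cobounded (Eu d)) (𝓝 0) := by
    have A : Tendsto (fun w : Eu d => ‖w‖ ^ 2) (Bornology.cobounded (Eu d)) atTop :=
      (tendsto_pow_atTop two_ne_zero).comp tendsto_norm_cobounded_atTop
    have B := ((tendsto_rpow_mul_exp_neg_mul_atTop_nhds_zero ((d : ℝ) / 2) (1 / 4)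
      (by norm_num)).comp A).const_mul ((4 * Real.pi * 1) ^ (-((d : ℝ) / 2)))
    rw [mul_zero] at B
    refine B.congr fun x => ?_
    simp only [Function.comp, hk, finrank_euclideanSpace, Fintype.card_fin, sub_zero]
    rw [← Real.rpow_natCast ‖x‖ 2, ← Real.rpow_mul (norm_nonneg _), ← Real.rpow_natCast ‖x‖ d]
    have e1 : ((2 : ℕ) : ℝ) * ((d : ℝ) / 2) = d := by push_cast; ring
    rw [e1]
    have e2 : -(‖x‖ ^ ((2 : ℕ) : ℝ)) / (4 * 1) = -(1 / 4) * ‖x‖ ^ ((2 : ℕ) : ℝ) := by ring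
    rw [e2]; ring
  have key := tendsto_integral_comp_smul_smul_of_integrable' (μ := volume) (φ := hk (0 : Eu d) 1)
    (fun x => (hk_pos 0 one_pos x).le) (hk_integral 0 one_pos) hdecay
    (hU.integrable_of_hasCompactSupport hs) (hU.continuousAt (x := x0))
  have hc : Tendsto (fun t : ℝ => (Real.sqrt t)⁻¹) (𝓝[>] 0) atTop := by
    apply tendsto_inv_nhdsGT_zero.comp
    rw [tendsto_nhdsWithin_iff]
    constructor
    · have : Tendsto Real.sqrt (𝓝 0) (𝓝 0) := by
        simpa using Real.continuous_sqrt.tendsto 0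
      exact this.mono_left nhdsWithin_le_nhds
    · filter_upwards [self_mem_nhdsWithin] with t ht
      exact Real.sqrt_pos.2 ht
  refine (key.comp hc).congr' ?_
  filter_upwards [self_mem_nhdsWithin] with t ht
  have ht : 0 < t := ht
  simp only [Function.comp]
  apply integral_congr_ae
  refine Eventually.of_forall fun x => ?_
  simp only [smul_eq_mul, hk, finrank_euclideanSpace, Fintype.card_fin, sub_zero]
  have e1 : ((Real.sqrt t)⁻¹) ^ d = t ^ (-((d : ℝ) / 2)) := by
    rw [Real.sqrt_eq_rpow, ← Real.rpow_neg ht.le, ← Real.rpow_natCast, ← Real.rpow_mul ht.le]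
    congr 1; ring
  have e2 : ‖(Real.sqrt t)⁻¹ • (x0 - x)‖ ^ 2 = ‖x - x0‖ ^ 2 / t := by
    rw [norm_smul, mul_pow, norm_inv, Real.norm_eq_abs, inv_pow, sq_abs, Real.sq_sqrt ht.le,
      norm_sub_rev]
    field_simp
  rw [e1, e2, Real.mul_rpow (x := 4 * Real.pi) (y := t) (by positivity) ht.le, mul_one]
  have e3 : -(‖x - x0‖ ^ 2 / t) / (4 * 1) = -‖x - x0‖ ^ 2 / (4 * t) := by field_simp
  rw [e3]
  ring

/-- classical solution, extended by zero -/
structure Sol {d : ℕ} (O : Set (Eu d)) (l : ℝ) (U : Eu d → ℝ) : Prop where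
  cont : Continuous U
  c2 : ContDiffOn ℝ 2 U O
  gt : ∀ x ∈ O, -1 < U x
  neg : ∀ x ∈ O, U x < 0
  zero : ∀ x ∉ O, U x = 0
  lap : ∀ x ∈ O, laplacian U x = l * (1 + U x)

/-- distribution of the extension -/
noncomputable def NN {d : ℕ} (l : ℝ) (U χ : Eu d → ℝ) : ℝ :=
  l * (∫ x, χ x) + l * (∫ x, U x * χ x) - ∫ x, U x * laplacian χ x

lemma ind_le {d : ℕ} {O : Set (Eu d)} (hO : IsOpen O) {χ : Eu d → ℝ} (hχ0 : ∀ x, 0 ≤ χ x)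
    (hi : Integrable χ) : ∫ x, O.indicator χ x ≤ ∫ x, χ x := by
  apply integral_mono (hi.indicator hO.measurableSet) hi
  exact indicator_le_self' fun x _ => hχ0 x

lemma NN_nonneg {d : ℕ} {O : Set (Eu d)} (hO : IsOpen O) (hOb : Bornology.IsBounded O)
    {l : ℝ} (hl : 0 < l) {U χ : Eu d → ℝ} (hU : Sol O l U) (hχ : ContDiff ℝ 2 χ)
    (hχ0 : ∀ x, 0 ≤ χ x) (hi : Integrable χ) : 0 ≤ NN l U χ := by
  have hs := hcs_of_zero hOb hU.zero
  have hk := kato hO hOb (q := fun x => (-1) * U x) (g := fun x => (-1) * (l * (1 + U x)))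
    (continuous_const.mul hU.cont) (contDiffOn_const.mul hU.c2)
    (fun x hx => by linarith [hU.neg x hx]) (fun x hx => by simp [hU.zero x hx])
    (continuous_const.mul (continuous_const.mul (continuous_const.add hU.cont)))
    (fun x hx => by rw [lap_const_mul (hU.c2.contDiffAt (hO.mem_nhds hx)), hU.lap x hx])
    hχ hχ0
  have IU : Integrable (fun x => U x * χ x) :=
    (hU.cont.mul hχ.continuous).integrable_of_hasCompactSupport hs.mul_right
  have e1 : ∀ x, O.indicator (fun x => (-1) * (l * (1 + U x)) * χ x) x =
      (-l) * O.indicator χ x + (-l) * (U x * χ x) := by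
    intro x
    by_cases hx : x ∈ O
    · simp only [indicator_of_mem hx]; ring
    · simp [indicator_of_notMem hx, hU.zero x hx]
  rw [integral_congr_ae (Eventually.of_forall e1), integral_add
    ((hi.indicator hO.measurableSet).const_mul _) (IU.const_mul _), integral_const_mul,
    integral_const_mul] at hk
  have e2 : ∫ x, (-1) * U x * laplacian χ x = - ∫ x, U x * laplacian χ x := by
    rw [← integral_neg]; congr 1; funext x; ring
  rw [e2] at hk
  have := mul_le_mul_of_nonneg_left (ind_le hO hχ0 hi) hl.le
  unfold NN
  linarith

lemma Sol_lt {d : ℕ} {O : Set (Eu d)} (hO : IsOpen O) (hOb : Bornology.IsBounded O)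
    {l m : ℝ} (hm : 0 < m) (hlm : m < l) {U V : Eu d → ℝ} (hU : Sol O l U) (hV : Sol O m V) :
    ∀ x ∈ O, U x < V x := by
  by_contra hcon
  push Not at hcon
  obtain ⟨x1, hx1, h1⟩ := hcon
  obtain ⟨x, hxc, hx⟩ := hOb.isCompact_closure.exists_isMaxOn ⟨x1, subset_closure hx1⟩
    (f := fun y => U y - V y) (hU.cont.sub hV.cont).continuousOn
  have hex : ∃ x ∈ O, IsMaxOn (fun y => U y - V y) (closure O) x ∧ V x ≤ U x := by
    by_cases hxO : x ∈ O
    · refine ⟨x, hxO, hx, ?_⟩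
      have := hx (subset_closure hx1)
      simp only [mem_ofPred_eq] at this
      linarith
    · refine ⟨x1, hx1, ?_, h1⟩
      intro y hy
      have := hx hy
      simp only [mem_ofPred_eq, hU.zero x hxO, hV.zero x hxO] at this ⊢
      linarith
  obtain ⟨x, hxO, hx, h⟩ := hex
  have hUc := hU.c2.contDiffAt (hO.mem_nhds hxO)
  have hVc := hV.c2.contDiffAt (hO.mem_nhds hxO)
  have hloc : IsLocalMax (fun y => U y - V y) x :=
    hx.isLocalMax (mem_of_superset (hO.mem_nhds hxO) subset_closure)
  have := lap_nonpos_of_isLocalMax (hUc.sub hVc) hloc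
  rw [lap_sub hUc hVc, hU.lap x hxO, hV.lap x hxO] at this
  have h2 := hU.gt x hxO
  nlinarith [mul_pos (sub_pos.2 hlm) (by linarith : 0 < 1 + U x)]

lemma NN_mono {d : ℕ} {O : Set (Eu d)} (hO : IsOpen O) (hOb : Bornology.IsBounded O)
    {l m : ℝ} (hm : 0 < m) (hlm : m < l) {U V χ : Eu d → ℝ} (hU : Sol O l U) (hV : Sol O m V)
    (hχ : ContDiff ℝ 2 χ) (hχ0 : ∀ x, 0 ≤ χ x) (hi : Integrable χ) :
    NN m V χ ≤ NN l U χ := by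
  have hsU := hcs_of_zero hOb hU.zero
  have hsV := hcs_of_zero hOb hV.zero
  have hlt := Sol_lt hO hOb hm hlm hU hV
  have hk := kato hO hOb (q := fun x => V x - U x)
    (g := fun x => m * (1 + V x) - l * (1 + U x))
    (hV.cont.sub hU.cont) (hV.c2.sub hU.c2)
    (fun x hx => by linarith [hlt x hx]) (fun x hx => by simp [hU.zero x hx, hV.zero x hx])
    ((continuous_const.mul (continuous_const.add hV.cont)).sub
      (continuous_const.mul (continuous_const.add hU.cont)))
    (fun x hx => by rw [lap_sub (hV.c2.contDiffAt (hO.mem_nhds hx))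
      (hU.c2.contDiffAt (hO.mem_nhds hx)), hU.lap x hx, hV.lap x hx])
    hχ hχ0
  have IU : Integrable (fun x => U x * χ x) :=
    (hU.cont.mul hχ.continuous).integrable_of_hasCompactSupport hsU.mul_right
  have IV : Integrable (fun x => V x * χ x) :=
    (hV.cont.mul hχ.continuous).integrable_of_hasCompactSupport hsV.mul_right
  have JU : Integrable (fun x => U x * laplacian χ x) :=
    (hU.cont.mul (cont_lap hχ)).integrable_of_hasCompactSupport hsU.mul_right
  have JV : Integrable (fun x => V x * laplacian χ x) :=
    (hV.cont.mul (cont_lap hχ)).integrable_of_hasCompactSupport hsV.mul_right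
  have e1 : ∀ x, O.indicator (fun x => (m * (1 + V x) - l * (1 + U x)) * χ x) x =
      (m - l) * O.indicator χ x + (m * (V x * χ x) - l * (U x * χ x)) := by
    intro x
    by_cases hx : x ∈ O
    · simp only [indicator_of_mem hx]; ring
    · simp [indicator_of_notMem hx, hU.zero x hx, hV.zero x hx]
  have e2 : ∀ x, (V x - U x) * laplacian χ x = V x * laplacian χ x - U x * laplacian χ x :=
    fun x => sub_mul _ _ _
  have I2 : Integrable (fun x => m * (V x * χ x) - l * (U x * χ x)) :=
    (IV.const_mul _).sub (IU.const_mul _)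
  rw [integral_congr_ae (Eventually.of_forall e1), integral_congr_ae (Eventually.of_forall e2),
    integral_add ((hi.indicator hO.measurableSet).const_mul _)
    I2, integral_sub (IV.const_mul _) (IU.const_mul _),
    integral_const_mul, integral_const_mul, integral_const_mul, integral_sub JV JU] at hk
  have := mul_le_mul_of_nonneg_left (ind_le hO hχ0 hi) (sub_pos.2 hlm).le
  unfold NN
  linarith


lemma NN_sub {d : ℕ} {O : Set (Eu d)} (hOb : Bornology.IsBounded O)
    {m : ℝ} {V χ ψ : Eu d → ℝ} (hV : Sol O m V)
    (hχ : ContDiff ℝ 2 χ) (hi : Integrable χ) (hψ : ContDiff ℝ 2 ψ) (hj : Integrable ψ) (c : ℝ) :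
    NN m V (fun x => χ x - c * ψ x) = NN m V χ - c * NN m V ψ := by
  have hs := hcs_of_zero hOb hV.zero
  have I1 : Integrable (fun x => V x * χ x) :=
    (hV.cont.mul hχ.continuous).integrable_of_hasCompactSupport hs.mul_right
  have I2 : Integrable (fun x => V x * ψ x) :=
    (hV.cont.mul hψ.continuous).integrable_of_hasCompactSupport hs.mul_right
  have J1 : Integrable (fun x => V x * laplacian χ x) :=
    (hV.cont.mul (cont_lap hχ)).integrable_of_hasCompactSupport hs.mul_right
  have J2 : Integrable (fun x => V x * laplacian ψ x) :=
    (hV.cont.mul (cont_lap hψ)).integrable_of_hasCompactSupport hs.mul_right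
  have e1 : ∫ x, (χ x - c * ψ x) = (∫ x, χ x) - c * ∫ x, ψ x := by
    rw [integral_sub hi (hj.const_mul c), integral_const_mul]
  have e2 : ∫ x, V x * (χ x - c * ψ x) = (∫ x, V x * χ x) - c * ∫ x, V x * ψ x := by
    rw [← integral_const_mul, ← integral_sub I1 (I2.const_mul c)]
    congr 1; funext x; ring
  have e3 : ∫ x, V x * laplacian (fun x => χ x - c * ψ x) x =
      (∫ x, V x * laplacian χ x) - c * ∫ x, V x * laplacian ψ x := by
    rw [← integral_const_mul, ← integral_sub J1 (J2.const_mul c)]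
    congr 1; funext x
    rw [lap_sub hχ.contDiffAt (contDiff_const.mul hψ).contDiffAt, lap_const_mul hψ.contDiffAt]
    ring
  unfold NN
  rw [e1, e2, e3]; ring

lemma Sol.ge {d : ℕ} {O : Set (Eu d)} {m : ℝ} {V : Eu d → ℝ} (hV : Sol O m V) (x : Eu d) :
    -1 ≤ V x := by
  by_cases hx : x ∈ O
  · exact (hV.gt x hx).le
  · rw [hV.zero x hx]; norm_num

lemma Sol.le {d : ℕ} {O : Set (Eu d)} {m : ℝ} {V : Eu d → ℝ} (hV : Sol O m V) (x : Eu d) :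
    V x ≤ 0 := by
  by_cases hx : x ∈ O
  · exact (hV.neg x hx).le
  · rw [hV.zero x hx]

lemma NN_hk {d : ℕ} (m : ℝ) (V : Eu d → ℝ) (y : Eu d) {t : ℝ} (ht : 0 < t) :
    NN m V (hk y t) = m * (1 + ∫ x, V x * hk y t x) - ∫ x, V x * laplacian (hk y t) x := by
  unfold NN
  rw [hk_integral y ht]; ring

lemma hk_ratio {d : ℕ} (y x : Eu d) {t δ : ℝ} (ht : 0 < t) (ht1 : t ≤ 1) (hδ : 0 < δ)
    (hx : δ ≤ ‖x - y‖) :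
    hk y t x ≤ (Real.exp (δ ^ 2 / 4) * ((t⁻¹) ^ ((d : ℝ) / 2) * Real.exp (-(δ ^ 2 / 4) * t⁻¹))) *
      hk y 1 x := by
  have hπ := Real.pi_pos
  unfold hk
  rw [Real.mul_rpow (x := 4 * Real.pi) (y := t) (by positivity) ht.le, mul_one,
    Real.inv_rpow ht.le, ← Real.rpow_neg ht.le]
  have e : Real.exp (-‖x - y‖ ^ 2 / (4 * t)) ≤ Real.exp (δ ^ 2 / 4) *
      Real.exp (-(δ ^ 2 / 4) * t⁻¹) * Real.exp (-‖x - y‖ ^ 2 / (4 * 1)) := by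
    rw [← Real.exp_add, ← Real.exp_add]
    apply Real.exp_le_exp.2
    have h1 : 1 ≤ t⁻¹ := (one_le_inv₀ ht).2 ht1
    have h2 : δ ^ 2 ≤ ‖x - y‖ ^ 2 := by gcongr
    have h3 : -‖x - y‖ ^ 2 / (4 * t) = -(‖x - y‖ ^ 2) / 4 * t⁻¹ := by field_simp
    rw [h3]
    nlinarith
  have hp : 0 ≤ (4 * Real.pi) ^ (-((d : ℝ) / 2)) * t ^ (-((d : ℝ) / 2)) := by positivity
  calc _ ≤ (4 * Real.pi) ^ (-((d : ℝ) / 2)) * t ^ (-((d : ℝ) / 2)) * (Real.exp (δ ^ 2 / 4) *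
      Real.exp (-(δ ^ 2 / 4) * t⁻¹) * Real.exp (-‖x - y‖ ^ 2 / (4 * 1))) :=
        mul_le_mul_of_nonneg_left e hp
    _ = _ := by ring

lemma exists_test {d : ℕ} {O : Set (Eu d)} (hOb : Bornology.IsBounded O)
    {m : ℝ} (hm : 0 < m) {V : Eu d → ℝ} (hV : Sol O m V)
    {y : Eu d} (hy : y ∉ O) {δ : ℝ} (hδ : 0 < δ) :
    ∃ χ : Eu d → ℝ, ∃ M : ℝ, ContDiff ℝ 2 χ ∧ Integrable χ ∧ 0 < M ∧ (∀ x, χ x ≤ M) ∧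
      (∀ x, δ ≤ ‖x - y‖ → χ x ≤ 0) ∧ 0 < NN m V χ := by
  have hπ := Real.pi_pos
  have hs := hcs_of_zero hOb hV.zero
  set η : ℝ → ℝ := fun t =>
    Real.exp (δ ^ 2 / 4) * ((t⁻¹) ^ ((d : ℝ) / 2) * Real.exp (-(δ ^ 2 / 4) * t⁻¹)) with hη
  have hηt : Tendsto η (𝓝[>] 0) (𝓝 0) := by
    have := ((tendsto_rpow_mul_exp_neg_mul_atTop_nhds_zero ((d : ℝ) / 2) (δ ^ 2 / 4)
      (by positivity)).comp (tendsto_inv_nhdsGT_zero (𝕜 := ℝ))).const_mul (Real.exp (δ ^ 2 / 4))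
    rw [mul_zero] at this
    exact this
  have hηN : Tendsto (fun t => η t * NN m V (hk y 1)) (𝓝[>] 0) (𝓝 0) := by
    simpa using hηt.mul_const (NN m V (hk y 1))
  have hB := B_tendsto hV.cont hs y
  rw [hV.zero y hy] at hB
  have ev : ∀ᶠ t in 𝓝[>] (0 : ℝ), η t * NN m V (hk y 1) < m / 8 ∧
      -(1 / 2) < ∫ x, V x * hk y t x :=
    (hηN.eventually_lt_const (by positivity)).and (hB.eventually_const_lt (by norm_num))
  obtain ⟨T0, hT0, hT⟩ := (mem_nhdsGT_iff_exists_Ioc_subset).1 ev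
  have hT0 : 0 < T0 := hT0
  set T := min T0 1 with hTdef
  have hTpos : 0 < T := lt_min hT0 one_pos
  have ev2 : ∀ᶠ a in 𝓝[>] (0 : ℝ), -(m / 4 * (T / 2)) < ∫ x, V x * hk y a x :=
    hB.eventually_const_lt (by have : 0 < m / 4 * (T / 2) := by positivity
                               linarith)
  have ev3 : ∀ᶠ a in 𝓝[>] (0 : ℝ), a < T / 2 :=
    nhdsWithin_le_nhds (eventually_lt_nhds (by positivity))
  obtain ⟨a, ⟨ha1, ha2⟩, ha3⟩ := ((ev2.and ev3).and self_mem_nhdsWithin).exists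
  have ha3 : 0 < a := ha3
  obtain ⟨c, hc, hc'⟩ := exists_hasDerivAt_eq_slope (fun t => ∫ x, V x * hk y t x)
    (fun t => ∫ x, V x * laplacian (hk y t) x) (show a < T by linarith)
    (fun t ht => (B_deriv hV.cont hs y (lt_of_lt_of_le ha3 ht.1)).continuousAt.continuousWithinAt)
    (fun t ht => B_deriv hV.cont hs y (ha3.trans ht.1))
  have hcpos : 0 < c := ha3.trans hc.1
  have hcT0 : c ≤ T0 := hc.2.le.trans (min_le_left _ _)
  have hc1 : c ≤ 1 := hc.2.le.trans (min_le_right _ _)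
  have hBT : ∫ x, V x * hk y T x ≤ 0 := integral_nonpos fun x =>
    mul_nonpos_of_nonpos_of_nonneg (hV.le x) (hk_pos y hTpos x).le
  have hder : ∫ x, V x * laplacian (hk y c) x ≤ m / 4 := by
    rw [hc', div_le_iff₀ (by linarith)]
    have : m / 4 * (T / 2) ≤ m / 4 * (T - a) := by
      apply mul_le_mul_of_nonneg_left _ (by positivity)
      linarith
    linarith
  obtain ⟨h1, h2⟩ := hT ⟨hcpos, hcT0⟩
  refine ⟨fun x => hk y c x - η c * hk y 1 x, (4 * Real.pi * c) ^ (-((d : ℝ) / 2)),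
    (hk_contDiff y c).sub (contDiff_const.mul (hk_contDiff y 1)),
    (hk_integrable y hcpos).sub ((hk_integrable y one_pos).const_mul _), by positivity, ?_, ?_, ?_⟩
  · intro x
    have e1 : 0 ≤ η c * hk y 1 x := by
      have := hk_pos y one_pos x
      positivity
    have e2 : hk y c x ≤ (4 * Real.pi * c) ^ (-((d : ℝ) / 2)) := by
      unfold hk
      apply mul_le_of_le_one_right (by positivity)
      apply Real.exp_le_one_iff.2
      apply div_nonpos_of_nonpos_of_nonneg _ (by positivity)
      have := sq_nonneg ‖x - y‖
      linarith
    linarith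
  · intro x hx
    have := hk_ratio y x hcpos hc1 hδ hx
    linarith
  · rw [NN_sub hOb hV (hk_contDiff y c) (hk_integrable y hcpos) (hk_contDiff y 1)
      (hk_integrable y one_pos), NN_hk m V y hcpos]
    nlinarith

lemma lower {d : ℕ} {O : Set (Eu d)} (hO : IsOpen O) (hOb : Bornology.IsBounded O)
    {l m : ℝ} (hm : 0 < m) (hlm : m < l) {U V χ : Eu d → ℝ} (hU : Sol O l U) (hV : Sol O m V)
    (hχ : ContDiff ℝ 2 χ) (hi : Integrable χ) {M : ℝ} (hM : 0 < M) (hχM : ∀ x, χ x ≤ M)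
    {y : Eu d} {δ : ℝ} (hχδ : ∀ x, δ ≤ ‖x - y‖ → χ x ≤ 0) (hκ : 0 < NN m V χ)
    {s : ℝ} (hs : 0 < s) (hls : l = 1 / s ^ 2) (x0 : Eu d) {D : ℝ} (hD : 0 < D)
    (hxD : ‖x0 - y‖ + δ ≤ D) :
    s ^ 2 * Real.exp (-1) * Real.exp (-D / s) *
      ((4 * Real.pi * (D * s / 2 + s ^ 2)) ^ (-((d : ℝ) / 2)) * (NN m V χ / M)) ≤ 1 + U x0 := by
  have hπ := Real.pi_pos
  have hcs := hcs_of_zero hOb hU.zero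
  have hl : 0 < l := hm.trans hlm
  set A : ℝ → ℝ := fun t => Real.exp (-l * t) * (1 + ∫ x, U x * hk x0 t x) with hA
  have hAd : ∀ t, 0 < t → HasDerivAt A (-(Real.exp (-l * t) * NN l U (hk x0 t))) t := by
    intro t ht
    have h1 : HasDerivAt (fun t => Real.exp (-l * t)) (Real.exp (-l * t) * (-l)) t := by
      have : HasDerivAt (fun t : ℝ => -l * t) (-l) t := by
        simpa using (hasDerivAt_id t).const_mul (-l)
      exact this.exp
    refine (h1.mul ((B_deriv hU.cont hcs x0 ht).const_add 1)).congr_deriv ?_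
    rw [NN_hk l U x0 ht]
    ring
  have hAlim : Tendsto A (𝓝[>] 0) (𝓝 (1 + U x0)) := by
    have h1 : Tendsto (fun t : ℝ => Real.exp (-l * t)) (𝓝[>] 0) (𝓝 1) := by
      have : Continuous (fun t : ℝ => Real.exp (-l * t)) := by fun_prop
      have := this.tendsto 0
      simp only [mul_zero, Real.exp_zero] at this
      exact this.mono_left nhdsWithin_le_nhds
    have h2 := h1.mul ((B_tendsto hU.cont hcs x0).const_add 1)
    rw [one_mul] at h2
    exact h2
  have hanti : AntitoneOn A (Ioi 0) := by
    apply antitoneOn_of_deriv_nonpos (convex_Ioi 0)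
    · exact fun t ht => (hAd t ht).continuousAt.continuousWithinAt
    · rw [interior_Ioi]
      exact fun t ht => (hAd t ht).differentiableAt.differentiableWithinAt
    · rw [interior_Ioi]
      intro t ht
      rw [(hAd t ht).deriv, neg_nonpos]
      exact mul_nonneg (Real.exp_pos _).le (NN_nonneg hO hOb hl hU (hk_contDiff x0 t)
        (fun x => (hk_pos x0 ht x).le) (hk_integrable x0 ht))
  set t0 := D * s / 2 with ht0
  have ht0p : 0 < t0 := by positivity
  set t1 := t0 + s ^ 2 with ht1
  have ht01 : t0 < t1 := by have : 0 < s ^ 2 := by positivity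
                            linarith
  have hA0 : A t0 ≤ 1 + U x0 := by
    refine ge_of_tendsto hAlim ?_
    have : ∀ᶠ t in 𝓝[>] (0 : ℝ), t < t0 := nhdsWithin_le_nhds (eventually_lt_nhds ht0p)
    filter_upwards [this, self_mem_nhdsWithin] with t h1 h2
    exact hanti h2 ht0p h1.le
  have hA1 : 0 ≤ A t1 := by
    apply mul_nonneg (Real.exp_pos _).le
    have ht1p := ht0p.trans ht01
    have : ∫ x, (-1) * hk x0 t1 x ≤ ∫ x, U x * hk x0 t1 x := by
      apply integral_mono ((hk_integrable x0 ht1p).const_mul _)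
        ((hU.cont.mul (hk_contDiff x0 t1).continuous).integrable_of_hasCompactSupport hcs.mul_right)
      intro x
      exact mul_le_mul_of_nonneg_right (hU.ge x) (hk_pos x0 ht1p x).le
    rw [integral_const_mul, hk_integral x0 ht1p] at this
    linarith
  obtain ⟨c, hc, hc'⟩ := exists_hasDerivAt_eq_slope A
    (fun t => -(Real.exp (-l * t) * NN l U (hk x0 t))) ht01
    (fun t ht => (hAd t (lt_of_lt_of_le ht0p ht.1)).continuousAt.continuousWithinAt)
    (fun t ht => hAd t (ht0p.trans ht.1))
  have hcp : 0 < c := ht0p.trans hc.1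
  set b := (4 * Real.pi * t1) ^ (-((d : ℝ) / 2)) * Real.exp (-D / (2 * s)) with hb
  have hbp : 0 < b := by positivity
  have hkb : ∀ x, ‖x - y‖ < δ → b ≤ hk x0 c x := by
    intro x hx
    unfold hk
    apply mul_le_mul _ _ (Real.exp_pos _).le (by positivity)
    · apply Real.rpow_le_rpow_of_nonpos (by positivity)
      · have := hc.2.le
        gcongr
      · have : (0 : ℝ) ≤ (d : ℝ) / 2 := by positivity
        linarith
    · apply Real.exp_le_exp.2
      have h1 : ‖x - x0‖ ≤ D := by
        have := norm_sub_le_norm_sub_add_norm_sub x y x0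
        rw [norm_sub_rev y x0] at this
        linarith
      have h2 : ‖x - x0‖ ^ 2 ≤ D ^ 2 := by gcongr
      have h3 : D / (2 * s) = D ^ 2 / (4 * t0) := by rw [ht0]; field_simp; ring
      have h4 : ‖x - x0‖ ^ 2 / (4 * c) ≤ D ^ 2 / (4 * t0) := by
        have := hc.1.le
        gcongr
      rw [neg_div, neg_div, h3]
      linarith
  have hN1 : NN m V (hk x0 c) ≤ NN l U (hk x0 c) :=
    NN_mono hO hOb hm hlm hU hV (hk_contDiff x0 c) (fun x => (hk_pos x0 hcp x).le)
      (hk_integrable x0 hcp)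
  have hN2 : 0 ≤ NN m V (fun x => hk x0 c x - b / M * χ x) := by
    apply NN_nonneg hO hOb hm hV ((hk_contDiff x0 c).sub (contDiff_const.mul hχ)) _
      ((hk_integrable x0 hcp).sub (hi.const_mul _))
    intro x
    have hbM : 0 < b / M := by positivity
    rcases lt_or_ge ‖x - y‖ δ with h | h
    · have h1 := hkb x h
      have h2 : b / M * χ x ≤ b / M * M := mul_le_mul_of_nonneg_left (hχM x) hbM.le
      rw [div_mul_cancel₀ _ hM.ne'] at h2
      linarith
    · have h2 := mul_nonpos_of_nonneg_of_nonpos hbM.le (hχδ x h)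
      linarith [hk_pos x0 hcp x]
  rw [NN_sub hOb hV (hk_contDiff x0 c) (hk_integrable x0 hcp) hχ hi] at hN2
  have hslope : (Real.exp (-l * c) * NN l U (hk x0 c)) * s ^ 2 = A t0 - A t1 := by
    have h5 : t1 - t0 = s ^ 2 := by rw [ht1]; ring
    rw [h5, eq_div_iff (by positivity)] at hc'
    linarith
  have hexp : Real.exp (-1) * Real.exp (-D / (2 * s)) ≤ Real.exp (-l * c) := by
    rw [← Real.exp_add]
    apply Real.exp_le_exp.2
    have h6 : l * c ≤ l * t1 := mul_le_mul_of_nonneg_left hc.2.le hl.le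
    have h7 : l * t1 = D / (2 * s) + 1 := by rw [ht1, ht0, hls]; field_simp
    rw [neg_div]
    linarith
  have hee : Real.exp (-D / s) = Real.exp (-D / (2 * s)) * Real.exp (-D / (2 * s)) := by
    rw [← Real.exp_add]; congr 1; field_simp; ring
  have hfin : b / M * NN m V χ ≤ NN l U (hk x0 c) := by linarith
  calc _ = (Real.exp (-1) * Real.exp (-D / (2 * s))) * (b / M * NN m V χ) * s ^ 2 := by
        rw [hee, hb]; ring
    _ ≤ Real.exp (-l * c) * NN l U (hk x0 c) * s ^ 2 := by
        gcongr
    _ = A t0 - A t1 := hslope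
    _ ≤ _ := by linarith

lemma upper {d : ℕ} {O : Set (Eu d)} (hO : IsOpen O) (hOb : Bornology.IsBounded O)
    {s : ℝ} (hs : 0 < s) {U : Eu d → ℝ} (hU : Sol O (1 / s ^ 2) U) {a δ R : ℝ} (ha : 0 < a)
    (hδ : 0 < δ) (hR : 0 ≤ R) (has : a ^ 2 + a * d * s / δ ≤ 1) {x0 : Eu d}
    (hx0 : x0 ∈ closure O) (hf : ∀ x ∈ frontier O, R ≤ ‖x - x0‖) :
    1 + U x0 ≤ Real.exp (a / s * (δ - √(R ^ 2 + δ ^ 2))) := by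
  set b := a / s with hb
  have hb0 : 0 < b := by positivity
  set F : ℝ → ℝ := fun t => Real.exp (b * (√(t + δ ^ 2) - √(R ^ 2 + δ ^ 2))) with hF
  set ψ : Eu d → ℝ := fun y => F (‖y - x0‖ ^ 2) with hψ
  have hFd : ∀ t, 0 < t + δ ^ 2 → HasDerivAt F (F t * (b * (1 / (2 * √(t + δ ^ 2))))) t := by
    intro t ht
    have h1 : HasDerivAt (fun t => t + δ ^ 2) 1 t := (hasDerivAt_id t).add_const _
    exact (((h1.sqrt ht.ne').sub_const (√(R ^ 2 + δ ^ 2))).const_mul b).exp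
  have hlapψ : ∀ x, laplacian ψ x ≤ 1 / s ^ 2 * ψ x := by
    intro x
    set ρ := ‖x - x0‖ ^ 2 with hρ
    have hρ0 : 0 ≤ ρ := by positivity
    have hρδ : 0 < ρ + δ ^ 2 := by positivity
    set r := √(ρ + δ ^ 2) with hr
    have hr0 : 0 < r := Real.sqrt_pos.2 hρδ
    have hr2 : r ^ 2 = ρ + δ ^ 2 := Real.sq_sqrt hρδ.le
    have hrδ : δ ≤ r := Real.le_sqrt_of_sq_le (by linarith)
    have h1 : HasDerivAt (fun t => t + δ ^ 2) 1 ρ := (hasDerivAt_id ρ).add_const _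
    have h2 := ((h1.sqrt hρδ.ne').const_mul 2).fun_inv (by positivity)
    have h3 := (hFd ρ hρδ).fun_mul (h2.const_mul b)
    have hF2 : HasDerivAt (fun t => F t * (b * (1 / (2 * √(t + δ ^ 2)))))
        (F ρ * (b ^ 2 / (4 * r ^ 2) - b / (4 * r ^ 3))) ρ := by
      simp only [one_div]
      refine h3.congr_deriv ?_
      rw [← hr]
      field_simp
      ring
    have h4 := lap_radial x0 x (F := F) (F' := fun t => F t * (b * (1 / (2 * √(t + δ ^ 2)))))
      (by
        have : ∀ᶠ t in 𝓝 ρ, 0 < t + δ ^ 2 :=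
          (continuous_id.add continuous_const).continuousAt.eventually (lt_mem_nhds hρδ)
        filter_upwards [this] with t ht using hFd t ht) hF2
    have hFp : 0 < F ρ := Real.exp_pos _
    have : laplacian ψ x = F ρ * (d * b / r + ρ * b ^ 2 / r ^ 2 - ρ * b / r ^ 3) := by
      rw [hψ, h4, ← hρ, ← hr]
      field_simp
      ring
    rw [this, mul_comm (1 / s ^ 2)]
    refine mul_le_mul_of_nonneg_left ?_ hFp.le
    have e1 : d * b / r ≤ d * b / δ := by gcongr
    have e2 : ρ * b ^ 2 / r ^ 2 ≤ b ^ 2 := by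
      rw [div_le_iff₀ (by positivity), hr2]
      nlinarith [sq_nonneg b, sq_nonneg δ, mul_nonneg (sq_nonneg b) (sq_nonneg δ)]
    have e3 : 0 ≤ ρ * b / r ^ 3 := by positivity
    have e4 : d * b / δ + b ^ 2 = (a ^ 2 + a * d * s / δ) / s ^ 2 := by
      rw [hb]; field_simp; ring
    have e5 : (a ^ 2 + a * d * s / δ) / s ^ 2 ≤ 1 / s ^ 2 := by gcongr
    linarith
  have hψc : ContDiff ℝ 2 ψ := by
    refine Real.contDiff_exp.comp (contDiff_const.mul (ContDiff.sub ?_ contDiff_const))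
    rw [contDiff_iff_contDiffAt]
    intro x
    exact ContDiffAt.sqrt ((contDiff_sq x0).add contDiff_const).contDiffAt (by positivity)
  have hg : Continuous fun y => U y - ψ y := hU.cont.sub hψc.continuous
  obtain ⟨x1, hx1, hmax⟩ := hOb.isCompact_closure.exists_isMaxOn ⟨x0, hx0⟩ hg.continuousOn
  have hle : 1 + (U x1 - ψ x1) ≤ 0 := by
    by_contra hcon
    push Not at hcon
    have hx1O : x1 ∈ O := by
      by_contra hx
      have hfr : x1 ∈ frontier O := ⟨hx1, by rwa [hO.interior_eq]⟩
      have h1 := hU.zero x1 hx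
      have h2 : 1 ≤ ψ x1 := by
        refine Real.one_le_exp (mul_nonneg hb0.le (sub_nonneg.2 (Real.sqrt_le_sqrt ?_)))
        have := hf x1 hfr
        gcongr
      linarith
    have hloc : IsLocalMax (fun y => U y - ψ y) x1 :=
      hmax.isLocalMax (mem_of_superset (hO.mem_nhds hx1O) subset_closure)
    have hUc : ContDiffAt ℝ 2 U x1 := hU.c2.contDiffAt (hO.mem_nhds hx1O)
    have h1 := lap_nonpos_of_isLocalMax (hUc.sub hψc.contDiffAt) hloc
    rw [lap_sub hUc hψc.contDiffAt, hU.lap x1 hx1O] at h1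
    have h2 := hlapψ x1
    have h3 : 0 < 1 / s ^ 2 * (1 + (U x1 - ψ x1)) := by positivity
    nlinarith
  have h := hmax hx0
  simp only [mem_ofPred_eq] at h
  have h5 : ψ x0 = Real.exp (b * (δ - √(R ^ 2 + δ ^ 2))) := by
    simp [hψ, hF, Real.sqrt_sq hδ.le]
  linarith

/-- uniform lower bound near one boundary point -/
lemma lower_unif {d : ℕ} {O : Set (Eu d)} (hO : IsOpen O) (hOb : Bornology.IsBounded O)
    {s : ℕ → ℝ} (hs : ∀ n, 0 < s n) (hs0 : Tendsto s atTop (𝓝 0)) {U : ℕ → Eu d → ℝ}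
    (hU : ∀ n, Sol O (1 / s n ^ 2) (U n)) {y : Eu d} (hy : y ∈ frontier O) {δ : ℝ} (hδ : 0 < δ) :
    ∀ᶠ n in atTop, ∀ x ∈ closure O, -‖x - y‖ - 2 * δ ≤ s n * Real.log (1 + U n x) := by
  have hπ := Real.pi_pos
  have hyO : y ∉ O := by
    have := hy.2
    rwa [hO.interior_eq] at this
  have hm : 0 < 1 / s 0 ^ 2 := by have := hs 0; positivity
  obtain ⟨χ, M, hχ, hi, hM, hχM, hχδ, hκ⟩ := exists_test hOb hm (hU 0) hyO hδ
  obtain ⟨C0, hC0⟩ := hOb.closure.exists_norm_le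
  set Dm := C0 + ‖y‖ + δ with hDm
  have hDmx : ∀ x ∈ closure O, ‖x - y‖ + δ ≤ Dm := fun x hx => by
    have := norm_sub_le x y
    have := hC0 x hx
    linarith
  have hDm0 : 0 < Dm := by
    have h1 := hDmx y hy.1
    simp at h1; linarith
  set C := 4 * Real.pi * (Dm / 2 + 1) with hC
  have hCp : 0 < C := by positivity
  set K := NN (1 / s 0 ^ 2) (U 0) χ / M with hK
  have hKp : 0 < K := by positivity
  set L := -1 + Real.log (C ^ (-((d : ℝ) / 2)) * K) with hL
  have hlim : Tendsto (fun n => 2 * (s n * Real.log (s n)) + s n * L) atTop (𝓝 0) := by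
    have h1 : Tendsto (fun n => s n * Real.log (s n)) atTop (𝓝 (0 * Real.log 0)) :=
      (Real.continuous_mul_log.tendsto 0).comp hs0
    simpa using (h1.const_mul 2).add (hs0.mul_const L)
  filter_upwards [hs0.eventually (gt_mem_nhds (hs 0)), hs0.eventually (gt_mem_nhds one_pos),
    hlim.eventually (lt_mem_nhds (show -δ < 0 by linarith))] with n hn0 hn1 hnL x hx
  have hsn := hs n
  have hD : 0 < ‖x - y‖ + δ := by positivity
  have hlm : 1 / s 0 ^ 2 < 1 / s n ^ 2 := by gcongr
  have hlow := lower hO hOb hm hlm (hU n) (hU 0) hχ hi hM hχM hχδ hκ hsn rfl x hD le_rfl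
  have hpre : C ^ (-((d : ℝ) / 2)) ≤
      (4 * Real.pi * ((‖x - y‖ + δ) * s n / 2 + s n ^ 2)) ^ (-((d : ℝ) / 2)) := by
    refine Real.rpow_le_rpow_of_nonpos (by positivity) ?_ (by simp; positivity)
    have := hDmx x hx
    have e1 : (‖x - y‖ + δ) * s n ≤ Dm * 1 := by gcongr
    have e2 : s n ^ 2 ≤ 1 := by nlinarith
    rw [hC]
    gcongr
    linarith
  have hlow2 : s n ^ 2 * Real.exp (-1) * Real.exp (-(‖x - y‖ + δ) / s n) *
      (C ^ (-((d : ℝ) / 2)) * K) ≤ 1 + U n x := le_trans (by gcongr) hlow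
  have hlog := Real.log_le_log (by positivity) hlow2
  rw [Real.log_mul (by positivity) (by positivity), Real.log_mul (by positivity) (by positivity),
    Real.log_mul (by positivity) (by positivity), Real.log_exp, Real.log_exp, Real.log_pow] at hlog
  have hfin := mul_le_mul_of_nonneg_left hlog hsn.le
  have e : s n * (((2 : ℕ) : ℝ) * Real.log (s n) + -1 + -(‖x - y‖ + δ) / s n +
      Real.log (C ^ (-((d : ℝ) / 2)) * K)) =
      2 * (s n * Real.log (s n)) + s n * L - (‖x - y‖ + δ) := by
    rw [hL]; field_simp; push_cast; ring
  rw [e] at hfin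
  linarith

lemma main_aux {d : ℕ} {O : Set (Eu d)} (hO : IsOpen O) (hOb : Bornology.IsBounded O)
    (hne : (frontier O).Nonempty)
    {s : ℕ → ℝ} (hs : ∀ n, 0 < s n) (hs0 : Tendsto s atTop (𝓝 0)) {U : ℕ → Eu d → ℝ}
    (hU : ∀ n, Sol O (1 / s n ^ 2) (U n)) :
    TendstoUniformlyOn (fun n x => s n * Real.log (1 + U n x))
        (fun x => -Metric.infDist x (frontier O)) atTop (closure O) := by
  have hfc : IsCompact (frontier O) :=
    hOb.isCompact_closure.of_isClosed_subset isClosed_frontier frontier_subset_closure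
  rw [Metric.tendstoUniformlyOn_iff]
  intro e he
  set δ := e / 4 with hδ
  have hδ0 : 0 < δ := by positivity
  obtain ⟨t, htf, htc⟩ := hfc.elim_nhds_subcover (fun y => ball y δ)
    (fun y _ => ball_mem_nhds y hδ0)
  have hlow : ∀ᶠ n in atTop, ∀ y ∈ t, ∀ x ∈ closure O,
      -‖x - y‖ - 2 * δ ≤ s n * Real.log (1 + U n x) :=
    (Finset.eventually_all t).2 fun y hy => lower_unif hO hOb hs hs0 hU (htf y hy) hδ0
  obtain ⟨C0, hC0⟩ := hOb.closure.exists_norm_le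
  obtain ⟨y0, hy0⟩ := hne
  have hRm : ∀ x ∈ closure O, infDist x (frontier O) ≤ 2 * C0 := fun x hx => by
    have h1 := infDist_le_dist_of_mem (x := x) hy0
    rw [dist_eq_norm] at h1
    have := norm_sub_le x y0
    have := hC0 x hx
    have := hC0 y0 hy0.1
    linarith
  have hC00 : 0 ≤ C0 := (norm_nonneg _).trans (hC0 y0 hy0.1)
  set a := 1 - min (1 / 2) (δ / (2 * C0 + 1)) with ha
  have hmin0 : 0 < min (1 / 2) (δ / (2 * C0 + 1)) := by positivity
  have hmin1 : min (1 / 2) (δ / (2 * C0 + 1)) ≤ 1 / 2 := min_le_left _ _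
  have hmin2 : min (1 / 2) (δ / (2 * C0 + 1)) ≤ δ / (2 * C0 + 1) := min_le_right _ _
  have ha0 : 0 < a := by linarith
  have ha1 : a < 1 := by linarith
  have hlima : Tendsto (fun n => a ^ 2 + a * d * s n / δ) atTop (𝓝 (a ^ 2)) := by
    simpa using ((hs0.const_mul (a * d)).div_const δ).const_add (a ^ 2)
  have haev := hlima.eventually (gt_mem_nhds (show a ^ 2 < 1 by nlinarith))
  filter_upwards [hlow, haev] with n hn hna x hx
  set R := infDist x (frontier O) with hR
  have hR0 : 0 ≤ R := infDist_nonneg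
  have hsn := hs n
  have h1 : -R - 3 * δ ≤ s n * Real.log (1 + U n x) := by
    obtain ⟨z, hz, hzd⟩ := hfc.exists_infDist_eq_dist ⟨y0, hy0⟩ x
    obtain ⟨y, hy, hzy⟩ := mem_iUnion₂.1 (htc hz)
    have h2 := hn y hy x hx
    have h3 := dist_triangle x z y
    rw [mem_ball] at hzy
    rw [← dist_eq_norm] at h2
    rw [← hR] at hzd
    linarith
  have hpos : 0 < 1 + U n x := by
    by_cases h : x ∈ O
    · linarith [(hU n).gt x h]
    · rw [(hU n).zero x h]; norm_num
  have h2 : s n * Real.log (1 + U n x) ≤ -R + 2 * δ := by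
    have h3 := upper hO hOb hsn (hU n) ha0 hδ0 hR0 hna.le hx (fun z hz => by
      have := infDist_le_dist_of_mem (x := x) hz
      rwa [dist_comm, dist_eq_norm] at this)
    have h4 := Real.log_le_log hpos h3
    rw [Real.log_exp] at h4
    have h5 := mul_le_mul_of_nonneg_left h4 hsn.le
    have h6 : s n * (a / s n * (δ - √(R ^ 2 + δ ^ 2))) = a * (δ - √(R ^ 2 + δ ^ 2)) := by
      field_simp
    have h7 : R ≤ √(R ^ 2 + δ ^ 2) := Real.le_sqrt_of_sq_le (by nlinarith)
    have h8 : a * (δ - √(R ^ 2 + δ ^ 2)) ≤ a * (δ - R) := by gcongr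
    have h9 : (1 - a) * R ≤ δ := by
      have := hRm x hx
      have e1 : 1 - a ≤ δ / (2 * C0 + 1) := by linarith
      calc (1 - a) * R ≤ δ / (2 * C0 + 1) * (2 * C0 + 1) := by
            apply mul_le_mul e1 (by linarith) hR0 (by positivity)
        _ = δ := by field_simp
    nlinarith
  rw [Real.dist_eq, abs_lt]
  constructor <;> linarith

lemma mk_sol {d : ℕ} {O : Set (Eu d)} (hO : IsOpen O) {ε : ℝ} (hε : 0 < ε) {u : Eu d → ℝ}
    (hcont : ContinuousOn u (closure O)) (hC2 : ContDiffOn ℝ 2 u O)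
    (hbound : ∀ x ∈ O, -1 < u x ∧ u x < 0) (hbdry : ∀ x ∈ frontier O, u x = 0)
    (heq : ∀ x ∈ O, -ε * laplacian u x + u x + 1 = 0) :
    Sol O (1 / √ε ^ 2) (O.indicator u) where
  cont := continuous_indicator hbdry hcont
  c2 := hC2.congr fun x hx => indicator_of_mem hx u
  gt x hx := by rw [indicator_of_mem hx]; exact (hbound x hx).1
  neg x hx := by rw [indicator_of_mem hx]; exact (hbound x hx).2
  zero x hx := indicator_of_notMem hx u
  lap x hx := by
    have : O.indicator u =ᶠ[𝓝 x] u := by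
      filter_upwards [hO.mem_nhds hx] with y hy using indicator_of_mem hy u
    rw [lap_congr this, indicator_of_mem hx, Real.sq_sqrt hε.le]
    have := heq x hx
    field_simp
    linarith

lemma final {d : ℕ} (O : Set (EuclideanSpace ℝ (Fin d))) (hO : IsOpen O)
    (hOne : O.Nonempty) (hOb : Bornology.IsBounded O)
    (ε : ℕ → ℝ) (hε : ∀ n, 0 < ε n) (hε0 : Tendsto ε atTop (𝓝 0))
    (u : ℕ → EuclideanSpace ℝ (Fin d) → ℝ)
    (hcont : ∀ n, ContinuousOn (u n) (closure O))
    (hC2 : ∀ n, ContDiffOn ℝ 2 (u n) O)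
    (hbound : ∀ n, ∀ x ∈ O, -1 < u n x ∧ u n x < 0)
    (hbdry : ∀ n, ∀ x ∈ frontier O, u n x = 0)
    (heq : ∀ n, ∀ x ∈ O, -(ε n) * laplacian (u n) x + u n x + 1 = 0) :
    ∀ K ⊆ closure O, IsCompact K →
      TendstoUniformlyOn (fun n x => Real.sqrt (ε n) * Real.log (1 + u n x))
        (fun x => -Metric.infDist x (frontier O)) atTop K := by
  intro K hK _
  rcases Nat.eq_zero_or_pos d with hd | hd
  · subst hd
    obtain ⟨x, hx⟩ := hOne
    have h1 := heq 0 x hx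
    have h2 := (hbound 0 x hx).1
    simp [laplacian] at h1
    linarith
  have : Nonempty (Fin d) := ⟨⟨0, hd⟩⟩
  have hne : (frontier O).Nonempty := by
    rw [nonempty_frontier_iff]
    refine ⟨hOne, fun h => ?_⟩
    rw [h] at hOb
    exact NormedSpace.unbounded_univ ℝ (EuclideanSpace ℝ (Fin d)) hOb
  have hs0 : Tendsto (fun n => √(ε n)) atTop (𝓝 0) := by
    simpa using hε0.sqrt
  have h := main_aux hO hOb hne (fun n => Real.sqrt_pos.2 (hε n)) hs0
    (fun n => mk_sol hO (hε n) (hcont n) (hC2 n) (hbound n) (hbdry n) (heq n))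
  refine (h.mono hK).congr (Eventually.of_forall fun n x hx => ?_)
  have hx' : O.indicator (u n) x = u n x := by
    by_cases hxO : x ∈ O
    · exact indicator_of_mem hxO _
    · rw [indicator_of_notMem hxO, hbdry n x ⟨hK hx, by rwa [hO.interior_eq]⟩]
  simp only [hx']

end EikonalAux

theorem stmt2 {d : ℕ} (O : Set (EuclideanSpace ℝ (Fin d))) (hO : IsOpen O)
    (hOne : O.Nonempty) (hOb : Bornology.IsBounded O)
    (ε : ℕ → ℝ) (hε : ∀ n, 0 < ε n) (hε0 : Tendsto ε atTop (𝓝 0))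
    (u : ℕ → EuclideanSpace ℝ (Fin d) → ℝ)
    (hcont : ∀ n, ContinuousOn (u n) (closure O))
    (hC2 : ∀ n, ContDiffOn ℝ 2 (u n) O)
    (hbound : ∀ n, ∀ x ∈ O, -1 < u n x ∧ u n x < 0)
    (hbdry : ∀ n, ∀ x ∈ frontier O, u n x = 0)
    (heq : ∀ n, ∀ x ∈ O, -(ε n) * laplacian (u n) x + u n x + 1 = 0) :
    ∀ K ⊆ closure O, IsCompact K →
      TendstoUniformlyOn (fun n x => Real.sqrt (ε n) * Real.log (1 + u n x))
        (fun x => -Metric.infDist x (frontier O)) atTop K := by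
  exact EikonalAux.final O hO hOne hOb ε hε hε0 u hcont hC2 hbound hbdry heq
end
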